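/- arXiv:1209.5325 — 6 statements merged into one kernel-verified Lean document; each statement's English description precedes it below -/
import Mathlib

section
/- For every TOPL automaton A with state set Q, at most d outgoing transitions from each state, and guards containing at most k conjuncts each, there exists a high-level TOPL automaton A' with |Q|+1 states and at most (d + k^d)·|Q| transitions such that the language of A (with TOPL semantics) equals the language of A' (with hl-TOPL semantics): L(A) = L(A'). -/
namespace Topl

/-- Guards over `m` registers and letters that are `n`-tuples. -/
inductive Guard (m n : ℕ) : Type
  | eq : Fin m → Fin n → Guard m n
  | neq : Fin m → Fin n → Guard m n
  | tt : Guard m n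
  | and : Guard m n → Guard m n → Guard m n
  deriving DecidableEq

/-- Actions over `m` registers and letters that are `n`-tuples. -/
inductive Action (m n : ℕ) : Type
  | nop : Action m n
  | set : Fin m → Fin n → Action m n
  | seq : Action m n → Action m n → Action m n
  deriving DecidableEq

/-- Satisfaction of a guard by a store `s` and a letter `ℓ`. -/
def Guard.Sat {V : Type} {m n : ℕ} (s : Fin m → V) (ℓ : Fin n → V) : Guard m n → Prop
  | .eq i j => s i = ℓ j
  | .neq i j => s i ≠ ℓ j
  | .tt => True
  | .and g₁ g₂ => Guard.Sat s ℓ g₁ ∧ Guard.Sat s ℓ g₂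

/-- The store transformation of an action on input letter `ℓ`:
`nop(ℓ)(s) = s`, `(set i := j)(ℓ)(s) = s[i ↦ ℓ(j)]`, `(a₁;a₂)(ℓ) = a₁(ℓ) ∘ a₂(ℓ)`. -/
def Action.run {V : Type} {m n : ℕ} (ℓ : Fin n → V) : Action m n → (Fin m → V) → (Fin m → V)
  | .nop, s => s
  | .set i j, s => Function.update s i (ℓ j)
  | .seq a₁ a₂, s => Action.run ℓ a₁ (Action.run ℓ a₂ s)

/-- A TOPL automaton with `m` registers over `n`-tuples, whose set of states is `Fin k`. -/
structure TOPL (V : Type) (m n k : ℕ) where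
  q₀ : Fin k
  s₀ : Fin m → V
  δ : Finset (Fin k × (Guard m n × Action m n) × Fin k)
  F : Finset (Fin k)

namespace TOPL

variable {V : Type} {m n k : ℕ}

/-- One edge of the configuration graph, labelled by a letter. -/
def Step (A : TOPL V m n k) (x₁ : Fin k × (Fin m → V)) (ℓ : Fin n → V)
    (x₂ : Fin k × (Fin m → V)) : Prop :=
  ∃ g a, (x₁.1, (g, a), x₂.1) ∈ A.δ ∧ Guard.Sat x₁.2 ℓ g ∧ Action.run ℓ a x₁.2 = x₂.2

/-- Walks in the configuration graph, labelled by words. -/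
inductive Reach (A : TOPL V m n k) :
    Fin k × (Fin m → V) → List (Fin n → V) → Fin k × (Fin m → V) → Prop
  | nil (x) : Reach A x [] x
  | cons {x₁ x₂ x₃ ℓ w} : A.Step x₁ ℓ x₂ → Reach A x₂ w x₃ → Reach A x₁ (ℓ :: w) x₃

/-- The language of a TOPL automaton: words labelling walks from the initial
configuration to a configuration whose state is final. -/
def Lang (A : TOPL V m n k) : Set (List (Fin n → V)) :=
  { w | ∃ x, A.Reach (A.q₀, A.s₀) w x ∧ x.1 ∈ A.F }

end TOPL

/-- A high-level TOPL automaton: transitions are labelled by finite sequences of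
guard–action pairs. -/
structure HlTOPL (V : Type) (m n k : ℕ) where
  q₀ : Fin k
  s₀ : Fin m → V
  δ : Finset (Fin k × List (Guard m n × Action m n) × Fin k)
  F : Finset (Fin k)

namespace HlTOPL

variable {V : Type} {m n k : ℕ}

/-- `SeqAccept s gas w s'` holds when the TOPL automaton `T(s; gas)` accepts the word `w`
ending with store `s'`. -/
inductive SeqAccept {V : Type} {m n : ℕ} :
    (Fin m → V) → List (Guard m n × Action m n) → List (Fin n → V) → (Fin m → V) → Prop
  | nil (s) : SeqAccept s [] [] s
  | cons {s s' g a gas ℓ w} : Guard.Sat s ℓ g → SeqAccept (Action.run ℓ a s) gas w s' →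
      SeqAccept s ((g, a) :: gas) (ℓ :: w) s'

/-- A standard transition starts from the hl-configuration `(x, v)`. -/
def StdFrom (A : HlTOPL V m n k) (x : Fin k × (Fin m → V)) (v : List (Fin n → V)) : Prop :=
  ∃ q₂ s₂ gas u u', v = u ++ u' ∧ (x.1, gas, q₂) ∈ A.δ ∧ SeqAccept x.2 gas u s₂

/-- One edge of the hl-configuration graph: a standard transition or a skip transition. -/
inductive HlStep (A : HlTOPL V m n k) :
    (Fin k × (Fin m → V)) × List (Fin n → V) → List (Fin n → V) →
    (Fin k × (Fin m → V)) × List (Fin n → V) → Prop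
  | std {q₁ s₁ q₂ s₂ gas w w'} : (q₁, gas, q₂) ∈ A.δ → SeqAccept s₁ gas w s₂ →
      HlStep A ((q₁, s₁), w ++ w') w ((q₂, s₂), w')
  | skip {q s ℓ w} : ¬ A.StdFrom (q, s) (ℓ :: w) → HlStep A ((q, s), ℓ :: w) [ℓ] ((q, s), w)

/-- Paths in the hl-configuration graph, labelled by the concatenation of the step labels. -/
inductive Path (A : HlTOPL V m n k) :
    (Fin k × (Fin m → V)) × List (Fin n → V) → List (Fin n → V) →
    (Fin k × (Fin m → V)) × List (Fin n → V) → Prop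
  | nil (y) : Path A y [] y
  | cons {y₁ y₂ y₃ u w} : A.HlStep y₁ u y₂ → Path A y₂ w y₃ → Path A y₁ (u ++ w) y₃

/-- The language of a high-level TOPL automaton: words labelling paths from an initial
hl-configuration to a final one. -/
def Lang (A : HlTOPL V m n k) : Set (List (Fin n → V)) :=
  { w | ∃ (w₀ : List (Fin n → V)) (q : Fin k) (s : Fin m → V),
      A.Path ((A.q₀, A.s₀), w₀) w ((q, s), ([] : List (Fin n → V))) ∧ q ∈ A.F }

end HlTOPL

/-- The number of conjuncts of a guard. -/
def Guard.conjuncts {m n : ℕ} : Guard m n → ℕ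
  | .and g₁ g₂ => Guard.conjuncts g₁ + Guard.conjuncts g₂
  | _ => 1

/-- The negations of the conjuncts of a guard; the conjunct `tt` contributes nothing. -/
def Guard.negations {m n : ℕ} : Guard m n → List (Guard m n)
  | .eq i j => [.neq i j]
  | .neq i j => [.eq i j]
  | .tt => []
  | .and g₁ g₂ => Guard.negations g₁ ++ Guard.negations g₂

/-- A disjunctive normal form of the negation of the disjunction of a list of guards. -/
def Guard.refutations {m n : ℕ} : List (Guard m n) → List (Guard m n)
  | [] => [.tt]
  | g :: gs => g.negations.flatMap fun h => (Guard.refutations gs).map (Guard.and h)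

namespace Guard

variable {V : Type} {m n : ℕ}

theorem one_le_conjuncts (g : Guard m n) : 1 ≤ g.conjuncts := by
  induction g <;> simp only [conjuncts] <;> omega

theorem length_negations_le (g : Guard m n) : g.negations.length ≤ g.conjuncts := by
  induction g with
  | and => simp only [conjuncts, negations, List.length_append]; omega
  | _ => simp [conjuncts, negations]

theorem exists_negations_sat_iff (s : Fin m → V) (ℓ : Fin n → V) (g : Guard m n) :
    (∃ h ∈ g.negations, Sat s ℓ h) ↔ ¬ Sat s ℓ g := by
  induction g with
  | and g₁ g₂ ih₁ ih₂ =>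
    simp only [negations, List.mem_append, or_and_right, exists_or, ih₁, ih₂, Sat]
    tauto
  | _ => simp [negations, Sat]

theorem length_refutations_le {c : ℕ} (gs : List (Guard m n))
    (hgs : ∀ g ∈ gs, g.conjuncts ≤ c) : (refutations gs).length ≤ c ^ gs.length := by
  induction gs with
  | nil => simp [refutations]
  | cons g gs ih =>
    have hg := (length_negations_le g).trans (hgs g (by simp))
    have hrec := ih fun h hh => hgs h (by simp [hh])
    simp only [refutations, List.length_flatMap, List.length_map, List.map_const',
      List.sum_replicate, smul_eq_mul, List.length_cons, pow_succ']
    exact Nat.mul_le_mul hg hrec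

theorem exists_refutations_sat_iff (s : Fin m → V) (ℓ : Fin n → V) (gs : List (Guard m n)) :
    (∃ h ∈ refutations gs, Sat s ℓ h) ↔ ∀ g ∈ gs, ¬ Sat s ℓ g := by
  induction gs with
  | nil => simp [refutations, Sat]
  | cons g gs ih =>
    rw [List.forall_mem_cons, ← ih, ← exists_negations_sat_iff]
    simp only [refutations, List.mem_flatMap, List.mem_map]
    constructor
    · rintro ⟨_, ⟨h, hh, h', hh', rfl⟩, hs, hs'⟩
      exact ⟨⟨h, hh, hs⟩, h', hh', hs'⟩
    · rintro ⟨⟨h, hh, hs⟩, h', hh', hs'⟩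
      exact ⟨_, ⟨h, hh, h', hh', rfl⟩, hs, hs'⟩

end Guard

theorem HlTOPL.seqAccept_singleton_iff {V : Type} {m n : ℕ} {s s' : Fin m → V} {g : Guard m n}
    {a : Action m n} {w : List (Fin n → V)} :
    SeqAccept s [(g, a)] w s' ↔ ∃ ℓ, w = [ℓ] ∧ g.Sat s ℓ ∧ a.run ℓ s = s' := by
  constructor
  · rintro (_ | ⟨hg, _ | _⟩)
    exact ⟨_, rfl, hg, rfl⟩
  · rintro ⟨ℓ, rfl, hg, rfl⟩
    exact .cons hg (.nil _)

namespace TOPL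

variable {V : Type} {m n k : ℕ}

/-- The transitions leaving a state. -/
def outgoing (A : TOPL V m n k) (q : Fin k) :
    Finset (Fin k × (Guard m n × Action m n) × Fin k) :=
  A.δ.filter fun t => t.1 = q

/-- Guards that together hold exactly when no transition leaving `q` is enabled. -/
noncomputable def stuckGuards (A : TOPL V m n k) (q : Fin k) : List (Guard m n) :=
  Guard.refutations ((A.outgoing q).toList.map fun t => t.2.1.1)

/-- The high-level automaton with an additional sink state, entered when no transition
of the original automaton is enabled. -/
noncomputable def toHl (A : TOPL V m n k) : HlTOPL V m n (k + 1) where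
  q₀ := A.q₀.castSucc
  s₀ := A.s₀
  δ := Finset.univ.biUnion fun q =>
    (A.outgoing q).image (fun t => (t.1.castSucc, [t.2.1], t.2.2.castSucc)) ∪
      (A.stuckGuards q).toFinset.image fun g => (q.castSucc, [(g, .nop)], Fin.last k)
  F := A.F.image Fin.castSucc

theorem exists_stuckGuards_sat_iff (A : TOPL V m n k) (q : Fin k) (s : Fin m → V)
    (ℓ : Fin n → V) : (∃ h ∈ A.stuckGuards q, h.Sat s ℓ) ↔
      ∀ g a p, (q, (g, a), p) ∈ A.δ → ¬ g.Sat s ℓ := by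
  rw [stuckGuards, Guard.exists_refutations_sat_iff]
  simp only [outgoing, List.mem_map, Finset.mem_toList, Finset.mem_filter]
  constructor
  · intro h g a p ht
    exact h g ⟨_, ⟨ht, rfl⟩, rfl⟩
  · rintro h _ ⟨⟨_, ⟨g, a⟩, p⟩, ⟨ht, rfl⟩, rfl⟩
    exact h g a p ht

theorem mem_toHl_δ (A : TOPL V m n k) {q₁ q₂ : Fin (k + 1)}
    {gas : List (Guard m n × Action m n)} :
    (q₁, gas, q₂) ∈ A.toHl.δ ↔
      (∃ q g a p, (q, (g, a), p) ∈ A.δ ∧ q₁ = q.castSucc ∧ gas = [(g, a)] ∧ q₂ = p.castSucc) ∨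
      ∃ q, ∃ g ∈ A.stuckGuards q, q₁ = q.castSucc ∧ gas = [(g, .nop)] ∧ q₂ = Fin.last k := by
  simp only [toHl, outgoing, Finset.mem_biUnion, Finset.mem_univ, true_and, Finset.mem_union,
    Finset.mem_image, Finset.mem_filter, List.mem_toFinset, Prod.mk.injEq]
  constructor
  · rintro ⟨q, ⟨⟨_, ⟨g, a⟩, p⟩, ⟨ht, rfl⟩, rfl, rfl, rfl⟩ | ⟨g, hg, rfl, rfl, rfl⟩⟩
    · exact .inl ⟨_, _, _, _, ht, rfl, rfl, rfl⟩
    · exact .inr ⟨_, _, hg, rfl, rfl, rfl⟩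
  · rintro (⟨q, g, a, p, ht, rfl, rfl, rfl⟩ | ⟨q, g, hg, rfl, rfl, rfl⟩)
    · exact ⟨q, .inl ⟨_, ⟨ht, rfl⟩, rfl, rfl, rfl⟩⟩
    · exact ⟨q, .inr ⟨g, hg, rfl, rfl, rfl⟩⟩

theorem card_outgoing_add_length_stuckGuards_le {d c : ℕ} (A : TOPL V m n k) (q : Fin k)
    (hout : (A.outgoing q).card ≤ d) (hguard : ∀ t ∈ A.δ, Guard.conjuncts t.2.1.1 ≤ c) :
    (A.outgoing q).card + (A.stuckGuards q).length ≤ d + c ^ d := by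
  rcases (A.outgoing q).eq_empty_or_nonempty with h | ⟨t, ht⟩
  · simp only [stuckGuards, h, Finset.toList_empty, List.map_nil, Guard.refutations,
      Finset.card_empty, List.length_singleton]
    rcases d with _ | d
    · simp
    · omega
  · have hc : 1 ≤ c :=
      (Guard.one_le_conjuncts _).trans (hguard t (Finset.mem_filter.1 ht).1)
    have hlen : (A.stuckGuards q).length ≤ c ^ (A.outgoing q).card := by
      refine (Guard.length_refutations_le (c := c) _ ?_).trans (by simp)
      simp only [outgoing, List.mem_map, Finset.mem_toList, Finset.mem_filter]
      rintro _ ⟨u, ⟨hu, -⟩, rfl⟩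
      exact hguard u hu
    exact Nat.add_le_add hout (hlen.trans (Nat.pow_le_pow_right hc hout))

theorem card_toHl_δ_le {d c : ℕ} (A : TOPL V m n k) (hout : ∀ q, (A.outgoing q).card ≤ d)
    (hguard : ∀ t ∈ A.δ, Guard.conjuncts t.2.1.1 ≤ c) :
    A.toHl.δ.card ≤ (d + c ^ d) * k := by
  have h := Finset.card_biUnion_le_card_mul (Finset.univ : Finset (Fin k)) (fun q =>
    (A.outgoing q).image (fun t => (t.1.castSucc, [t.2.1], t.2.2.castSucc)) ∪
      (A.stuckGuards q).toFinset.image fun g => (q.castSucc, [(g, .nop)], Fin.last k))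
    (d + c ^ d) fun q _ => (Finset.card_union_le _ _).trans <|
      (Nat.add_le_add Finset.card_image_le
        (Finset.card_image_le.trans (List.toFinset_card_le _))).trans
      (A.card_outgoing_add_length_stuckGuards_le q (hout q) hguard)
  simpa [toHl, mul_comm] using h

theorem toHl_stdFrom (A : TOPL V m n k) (q : Fin k) (s : Fin m → V) (ℓ : Fin n → V)
    (w : List (Fin n → V)) : A.toHl.StdFrom (q.castSucc, s) (ℓ :: w) := by
  by_cases h : ∃ g ∈ A.stuckGuards q, g.Sat s ℓ
  · obtain ⟨g, hg, hs⟩ := h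
    exact ⟨Fin.last k, _, [(g, .nop)], [ℓ], w, rfl,
      A.mem_toHl_δ.2 (.inr ⟨q, g, hg, rfl, rfl, rfl⟩),
      HlTOPL.seqAccept_singleton_iff.2 ⟨ℓ, rfl, hs, rfl⟩⟩
  · rw [exists_stuckGuards_sat_iff] at h
    push Not at h
    obtain ⟨g, a, p, ht, hs⟩ := h
    exact ⟨p.castSucc, _, [(g, a)], [ℓ], w, rfl,
      A.mem_toHl_δ.2 (.inl ⟨q, g, a, p, ht, rfl, rfl, rfl⟩),
      HlTOPL.seqAccept_singleton_iff.2 ⟨ℓ, rfl, hs, rfl⟩⟩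

theorem Reach.toHl_path {A : TOPL V m n k} {x y : Fin k × (Fin m → V)}
    {w : List (Fin n → V)} (h : A.Reach x w y) :
    A.toHl.Path ((x.1.castSucc, x.2), w) w ((y.1.castSucc, y.2), []) := by
  induction h with
  | nil x => exact .nil _
  | @cons x₁ x₂ x₃ ℓ w hstep _ ih =>
    obtain ⟨g, a, ht, hs, ha⟩ := hstep
    exact .cons (u := [ℓ]) (.std (w := [ℓ]) (w' := w)
      (A.mem_toHl_δ.2 (.inl ⟨_, g, a, _, ht, rfl, rfl, rfl⟩))
      (HlTOPL.seqAccept_singleton_iff.2 ⟨ℓ, rfl, hs, ha⟩)) ih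

theorem toHl_path_last {A : TOPL V m n k}
    {y z : (Fin (k + 1) × (Fin m → V)) × List (Fin n → V)} {w : List (Fin n → V)}
    (h : A.toHl.Path y w z) (hy : y.1.1 = Fin.last k) : z.1.1 = Fin.last k := by
  induction h with
  | nil => exact hy
  | cons hstep _ ih =>
    cases hstep with
    | std ht _ =>
      obtain ⟨q, -, -, -, -, hq, -⟩ | ⟨q, -, -, hq, -⟩ := A.mem_toHl_δ.1 ht <;>
        exact absurd (hq.symm.trans hy) (Fin.castSucc_ne_last q)
    | skip _ => exact ih hy

theorem reach_of_toHl_path {A : TOPL V m n k}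
    {y z : (Fin (k + 1) × (Fin m → V)) × List (Fin n → V)} {w : List (Fin n → V)}
    (h : A.toHl.Path y w z) {q p : Fin k} (hy : y.1.1 = q.castSucc)
    (hz : z.1.1 = p.castSucc) : A.Reach (q, y.1.2) w (p, z.1.2) := by
  induction h generalizing q with
  | nil y =>
    obtain rfl := Fin.castSucc_injective k (hy.symm.trans hz)
    exact .nil _
  | cons hstep hpath ih =>
    cases hstep with
    | std hmem hacc =>
      obtain ⟨q', g, a, r, ht, hq, rfl, hr⟩ | ⟨-, -, -, -, -, hr⟩ := A.mem_toHl_δ.1 hmem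
      · obtain rfl := Fin.castSucc_injective k (hq.symm.trans hy)
        obtain ⟨ℓ, rfl, hs, ha⟩ := HlTOPL.seqAccept_singleton_iff.1 hacc
        exact .cons ⟨g, a, ht, hs, ha⟩ (ih hr hz)
      · exact absurd (hz.symm.trans (toHl_path_last hpath hr)) (Fin.castSucc_ne_last p)
    | skip hn =>
      obtain rfl := hy
      exact absurd (A.toHl_stdFrom q _ _ _) hn

theorem lang_toHl (A : TOPL V m n k) : A.toHl.Lang = A.Lang := by
  ext w
  constructor
  · rintro ⟨w₀, q, s, hpath, hq⟩
    obtain ⟨p, hp, rfl⟩ := Finset.mem_image.1 hq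
    exact ⟨(p, s), reach_of_toHl_path hpath rfl rfl, hp⟩
  · rintro ⟨x, hreach, hx⟩
    exact ⟨w, _, _, hreach.toHl_path, Finset.mem_image_of_mem _ hx⟩

end TOPL

/-- TOPL to hl-TOPL: every TOPL automaton `A` with `nq` states, at most `d` outgoing
transitions from each state, and guards with at most `c` conjuncts each, is equivalent to
a high-level TOPL automaton `A'` with `nq + 1` states and at most `(d + c^d)·nq`
transitions: `L(A) = L(A')`. -/
theorem topl_to_hlTopl (V : Type) [Infinite V] (m n nq d c : ℕ) (A : TOPL V m n nq)
    (hout : ∀ q : Fin nq, (A.δ.filter fun t => t.1 = q).card ≤ d)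
    (hguard : ∀ t ∈ A.δ, Guard.conjuncts t.2.1.1 ≤ c) :
    ∃ A' : HlTOPL V m n (nq + 1),
      A'.δ.card ≤ (d + c ^ d) * nq ∧ A.Lang = A'.Lang := by
  exact ⟨A.toHl, A.card_toHl_δ_le hout hguard, A.lang_toHl.symm⟩

end Topl
end

section
/- A language L ⊆ (V^n)* is recognized by some TOPL automaton if and only if it is recognized by some high-level TOPL automaton; that is, TOPL automata and hl-TOPL automata are equally expressive. -/
namespace Topl

/-- Truth of a guard, given which registers agree with which letter components. -/
def Guard.Holds {m n : ℕ} (E : Fin m → Fin n → Prop) : Guard m n → Prop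
  | .eq i j => E i j
  | .neq i j => ¬ E i j
  | .tt => True
  | .and g₁ g₂ => Guard.Holds E g₁ ∧ Guard.Holds E g₂

theorem Guard.holds_iff_sat {V : Type} {m n : ℕ} (s : Fin m → V) (ℓ : Fin n → V)
    (g : Guard m n) : g.Holds (fun i j => s i = ℓ j) ↔ g.Sat s ℓ := by
  induction g <;> simp_all [Guard.Holds, Guard.Sat]

/-- The register or letter component from which an action takes the new value of a register. -/
def Action.source {m n : ℕ} : Action m n → Fin m → Fin m ⊕ Fin n
  | .nop, i => .inl i
  | .set i j, i' => if i' = i then .inr j else .inl i'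
  | .seq a₁ a₂, i => Sum.elim (Action.source a₂) .inr (Action.source a₁ i)

theorem Action.run_eq_elim_source {V : Type} {m n : ℕ} (ℓ : Fin n → V) (a : Action m n)
    (s : Fin m → V) (i : Fin m) : Action.run ℓ a s i = Sum.elim s ℓ (a.source i) := by
  induction a generalizing s i with
  | nop => rfl
  | set i' j => by_cases h : i = i' <;> simp [Action.run, Action.source, h]
  | seq a₁ a₂ h₁ h₂ =>
    simp only [Action.run, Action.source, h₁]
    cases Action.source a₁ i <;> simp [h₂]

/-- Finite families of guards have a conjunction. -/
theorem Guard.exists_forall {V ι : Type} [Finite ι] {m n : ℕ}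
    (P : ι → (Fin m → V) → (Fin n → V) → Prop)
    (h : ∀ i, ∃ g : Guard m n, ∀ s ℓ, g.Sat s ℓ ↔ P i s ℓ) :
    ∃ g : Guard m n, ∀ s ℓ, g.Sat s ℓ ↔ ∀ i, P i s ℓ := by
  classical
  have := Fintype.ofFinite ι
  choose g hg using h
  have key (t : Finset ι) : ∃ g : Guard m n, ∀ s ℓ, g.Sat s ℓ ↔ ∀ i ∈ t, P i s ℓ := by
    induction t using Finset.induction_on with
    | empty => exact ⟨.tt, by simp [Guard.Sat]⟩
    | insert i t _ ih =>
      obtain ⟨g', hg'⟩ := ih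
      exact ⟨.and (g i) g', by simp [Guard.Sat, hg, hg']⟩
  simpa using key Finset.univ

/-- An action can store all letter components in prescribed distinct registers. -/
theorem Action.exists_store {V : Type} {m n : ℕ} (f : Fin n → Fin m) (hf : f.Injective) :
    ∃ a : Action m n, ∀ (ℓ : Fin n → V) (s : Fin m → V),
      (∀ j, Action.run ℓ a s (f j) = ℓ j) ∧ ∀ i ∉ Set.range f, Action.run ℓ a s i = s i := by
  have key (t : Finset (Fin n)) : ∃ a : Action m n, ∀ (ℓ : Fin n → V) (s : Fin m → V),
      (∀ j ∈ t, Action.run ℓ a s (f j) = ℓ j) ∧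
        ∀ i ∉ Set.range f, Action.run ℓ a s i = s i := by
    induction t using Finset.induction_on with
    | empty => exact ⟨.nop, by simp [Action.run]⟩
    | insert j t _ ih =>
      obtain ⟨a, ha⟩ := ih
      refine ⟨.seq (.set (f j) j) a, fun ℓ s => ⟨fun j' hj' => ?_, fun i hi => ?_⟩⟩
      · rcases eq_or_ne j' j with rfl | hne
        · simp [Action.run]
        · have := (ha ℓ s).1 j' ((Finset.mem_insert.1 hj').resolve_left hne)
          simpa [Action.run, Function.update_apply, hf.eq_iff, hne] using this
      · have : i ≠ f j := fun h => hi ⟨j, h.symm⟩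
        simpa [Action.run, Function.update_apply, this] using (ha ℓ s).2 i hi
  simpa using key Finset.univ

namespace TOPL

variable {V : Type} {m n k : ℕ}

/-- Acceptance of a word from a configuration. -/
def Accepts (A : TOPL V m n k) (q : Fin k) (s : Fin m → V) (w : List (Fin n → V)) : Prop :=
  ∃ x, A.Reach (q, s) w x ∧ x.1 ∈ A.F

theorem accepts_nil (A : TOPL V m n k) (q : Fin k) (s : Fin m → V) :
    A.Accepts q s [] ↔ q ∈ A.F := by
  constructor
  · rintro ⟨x, h, hx⟩
    cases h
    exact hx
  · exact fun h => ⟨_, .nil _, h⟩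

theorem accepts_cons (A : TOPL V m n k) (q : Fin k) (s : Fin m → V) (ℓ : Fin n → V)
    (w : List (Fin n → V)) :
    A.Accepts q s (ℓ :: w) ↔
      ∃ g a q', (q, (g, a), q') ∈ A.δ ∧ g.Sat s ℓ ∧ A.Accepts q' (a.run ℓ s) w := by
  constructor
  · rintro ⟨x, h, hx⟩
    cases h with
    | cons h₁ h₂ =>
      obtain ⟨g, a, hδ, hg, ha⟩ := h₁
      exact ⟨g, a, _, hδ, hg, x, ha ▸ h₂, hx⟩
  · rintro ⟨g, a, q', hδ, hg, x, h, hx⟩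
    exact ⟨x, .cons ⟨g, a, hδ, hg, rfl⟩ h, hx⟩

end TOPL

/-- A register automaton whose transitions test the whole equality pattern between registers and
letter components, and may copy registers. -/
structure CopyMachine (n : ℕ) (Q R : Type) where
  step : Q → (R → Fin n → Prop) → (R → R ⊕ Fin n) → Q → Prop
  final : Q → Prop

namespace CopyMachine

variable {V : Type} {n : ℕ} {Q R : Type}

/-- Acceptance of a word from a state and register contents. -/
def Accepts (M : CopyMachine n Q R) : Q → (R → V) → List (Fin n → V) → Prop
  | q, _, [] => M.final q
  | q, s, ℓ :: w => ∃ u q', M.step q (fun r j => s r = ℓ j) u q' ∧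
      M.Accepts q' (fun r => Sum.elim s ℓ (u r)) w

/-- Copying is simulated by renaming registers, with `n` spare registers for the next letter. -/
theorem exists_topl [Nonempty V] [Finite Q] [Finite R] (M : CopyMachine n Q R) (q₀ : Q)
    (s₀ : R → V) : ∃ (m k : ℕ) (A : TOPL V m n k), A.Lang = {w | M.Accepts q₀ s₀ w} := by
  classical
  have := Fintype.ofFinite R
  set m := Fintype.card R + n with hm
  have hfree (ρ : R → Fin m) : ∃ f : Fin n → Fin m, f.Injective ∧ ∀ r j, ρ r ≠ f j := by
    have hcard := Finset.card_image_le (s := Finset.univ) (f := ρ)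
    rw [Finset.card_univ] at hcard
    obtain ⟨f⟩ := Function.Embedding.nonempty_of_card_le (α := Fin n)
      (β := ((Finset.univ.image ρ)ᶜ : Finset (Fin m))) (by
        rw [Fintype.card_coe, Finset.card_compl, Fintype.card_fin, Fintype.card_fin]
        omega)
    refine ⟨fun j => f j, fun i j h => f.injective (Subtype.ext h), fun r j h => ?_⟩
    have := (f j).2
    simp only [Finset.mem_compl, Finset.mem_image, Finset.mem_univ, true_and] at this
    exact this ⟨r, h⟩
  choose free free_inj free_ne using hfree
  choose save hsave using fun ρ => Action.exists_store (V := V) (free ρ) (free_inj ρ)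
  have hguard (ρ : R → Fin m) (E : R → Fin n → Prop) : ∃ g : Guard m n,
      ∀ (s : Fin m → V) ℓ, g.Sat s ℓ ↔ ∀ p : R × Fin n, (s (ρ p.1) = ℓ p.2 ↔ E p.1 p.2) := by
    refine Guard.exists_forall (fun (p : R × Fin n) s ℓ => (s (ρ p.1) = ℓ p.2 ↔ E p.1 p.2))
      fun p => ?_
    by_cases h : E p.1 p.2
    · exact ⟨.eq (ρ p.1) p.2, by simp [Guard.Sat, h]⟩
    · exact ⟨.neq (ρ p.1) p.2, by simp [Guard.Sat, h]⟩
  choose test htest using hguard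
  obtain ⟨k, ⟨e⟩⟩ := Finite.exists_equiv_fin (Q × (R → Fin m))
  let rename (ρ : R → Fin m) (u : R → R ⊕ Fin n) : R → Fin m := fun r => Sum.elim ρ (free ρ) (u r)
  let trans : Set (Fin k × (Guard m n × Action m n) × Fin k) :=
    (fun x : Q × (R → Fin m) × (R → Fin n → Prop) × (R → R ⊕ Fin n) × Q =>
      (e (x.1, x.2.1), (test x.2.1 x.2.2.1, save x.2.1),
        e (x.2.2.2.2, rename x.2.1 x.2.2.2.1))) ''
      {x | M.step x.1 x.2.2.1 x.2.2.2.1 x.2.2.2.2}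
  have htrans : trans.Finite := (Set.toFinite _).image _
  obtain ⟨ρ₀, hρ₀⟩ : ∃ ρ : R → Fin m, ρ.Injective := by
    obtain ⟨f⟩ := Function.Embedding.nonempty_of_card_le (α := R) (β := Fin m) (by simp [hm])
    exact ⟨f, f.injective⟩
  let A : TOPL V m n k :=
    { q₀ := e (q₀, ρ₀)
      s₀ := Function.extend ρ₀ s₀ fun _ => Classical.arbitrary V
      δ := htrans.toFinset
      F := Finset.univ.filter fun i => M.final (e.symm i).1 }
  have key (w : List (Fin n → V)) : ∀ q ρ (s : Fin m → V),
      A.Accepts (e (q, ρ)) s w ↔ M.Accepts q (fun r => s (ρ r)) w := by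
    induction w with
    | nil => intro q ρ s; simp [TOPL.accepts_nil, A, Accepts]
    | cons ℓ w ih =>
      intro q ρ s
      have hren (u : R → R ⊕ Fin n) : (fun r => (save ρ).run ℓ s (rename ρ u r)) =
          fun r => Sum.elim (fun r => s (ρ r)) ℓ (u r) := by
        funext r
        simp only [rename]
        cases u r with
        | inl r' =>
          refine (hsave ρ ℓ s).2 _ ?_
          rintro ⟨j, hj⟩
          exact free_ne ρ r' j hj.symm
        | inr j => exact (hsave ρ ℓ s).1 j
      rw [TOPL.accepts_cons, Accepts]
      constructor
      · rintro ⟨g, a, q', hδ, hg, hacc⟩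
        obtain ⟨⟨q₁, ρ₁, E, u, q₂⟩, hstep, heq⟩ := htrans.mem_toFinset.1 hδ
        simp only [Prod.mk.injEq, EmbeddingLike.apply_eq_iff_eq] at heq
        obtain ⟨⟨rfl, rfl⟩, ⟨rfl, rfl⟩, rfl⟩ := heq
        rw [ih, hren] at hacc
        refine ⟨u, q₂, ?_, hacc⟩
        have hE : (fun r j => s (ρ₁ r) = ℓ j) = E := by
          funext r j
          exact propext ((htest ρ₁ E s ℓ).1 hg (r, j))
        exact hE ▸ hstep
      · rintro ⟨u, q', hstep, hacc⟩
        refine ⟨_, _, _, htrans.mem_toFinset.2 ⟨⟨q, ρ, _, u, q'⟩, hstep, rfl⟩, ?_, ?_⟩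
        · exact (htest _ _ _ _).2 fun p => Iff.rfl
        · rw [ih, hren]
          exact hacc
  refine ⟨m, k, A, Set.ext fun w => (key w q₀ ρ₀ _).trans ?_⟩
  simp only [A, hρ₀.extend_apply]
  rfl

end CopyMachine

namespace HlTOPL

variable {V : Type} {m n k : ℕ}

/-- Acceptance of a word from a configuration. -/
def Accepts (A : HlTOPL V m n k) (q : Fin k) (s : Fin m → V) (w : List (Fin n → V)) : Prop :=
  ∃ u q' s', A.Path ((q, s), w) u ((q', s'), []) ∧ q' ∈ A.F

/-- Acceptance of a word in the middle of a standard transition to `q` that still has to process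
the labels `gas`. -/
def Resumes (A : HlTOPL V m n k) (gas : List (Guard m n × Action m n)) (q : Fin k)
    (s : Fin m → V) (w : List (Fin n → V)) : Prop :=
  ∃ u w' s', w = u ++ w' ∧ SeqAccept s gas u s' ∧ A.Accepts q s' w'

/-- Some prefix of `w` is accepted by `T(s; gas)`. -/
def Fires (s : Fin m → V) (gas : List (Guard m n × Action m n)) (w : List (Fin n → V)) : Prop :=
  ∃ u w' s', w = u ++ w' ∧ SeqAccept s gas u s'

/-- Reachability by transitions that read no letter. -/
def Silent (A : HlTOPL V m n k) : Fin k → Fin k → Prop :=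
  Relation.ReflTransGen fun q q' => (q, [], q') ∈ A.δ

theorem Path.eq_append {A : HlTOPL V m n k} {y u z} (h : A.Path y u z) : y.2 = u ++ z.2 := by
  induction h with
  | nil => rfl
  | cons h _ ih => cases h <;> simp_all

theorem mem_lang {A : HlTOPL V m n k} {w : List (Fin n → V)} :
    w ∈ A.Lang ↔ A.Accepts A.q₀ A.s₀ w := by
  constructor
  · rintro ⟨w₀, q, s, h, hq⟩
    obtain rfl : w₀ = w := by simpa using h.eq_append
    exact ⟨_, q, s, h, hq⟩
  · rintro ⟨u, q, s, h, hq⟩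
    obtain rfl : w = u := by simpa using h.eq_append
    exact ⟨_, q, s, h, hq⟩

theorem fires_nil (s : Fin m → V) (w : List (Fin n → V)) : Fires s [] w :=
  ⟨[], w, s, rfl, .nil s⟩

theorem fires_cons_nil (s : Fin m → V) (x : Guard m n × Action m n)
    (gas : List (Guard m n × Action m n)) : ¬ Fires s (x :: gas) [] := by
  rintro ⟨u, w', s', h, hs⟩
  cases hs
  simp at h

theorem fires_cons_cons (s : Fin m → V) (x : Guard m n × Action m n)
    (gas : List (Guard m n × Action m n)) (ℓ : Fin n → V) (w : List (Fin n → V)) :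
    Fires s (x :: gas) (ℓ :: w) ↔ x.1.Sat s ℓ ∧ Fires (x.2.run ℓ s) gas w := by
  constructor
  · rintro ⟨u, w', s', h, hs⟩
    cases hs with
    | cons hg hs =>
      obtain ⟨rfl, rfl⟩ := by simpa using h
      exact ⟨hg, _, _, _, rfl, hs⟩
  · rintro ⟨hg, u, w', s', rfl, hs⟩
    exact ⟨ℓ :: u, w', s', rfl, .cons hg hs⟩

theorem stdFrom_iff {A : HlTOPL V m n k} {q : Fin k} {s : Fin m → V} {w : List (Fin n → V)} :
    A.StdFrom (q, s) w ↔ ∃ t ∈ A.δ, t.1 = q ∧ Fires s t.2.1 w := by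
  constructor
  · rintro ⟨q', s', gas, u, u', h, hδ, hs⟩
    exact ⟨_, hδ, rfl, u, u', s', h, hs⟩
  · rintro ⟨⟨q, gas, q'⟩, hδ, rfl, u, u', s', h, hs⟩
    exact ⟨q', s', gas, u, u', h, hδ, hs⟩

theorem resumes_nil {A : HlTOPL V m n k} {q : Fin k} {s : Fin m → V} {w : List (Fin n → V)} :
    A.Resumes [] q s w ↔ A.Accepts q s w := by
  constructor
  · rintro ⟨u, w', s', rfl, hs, h⟩
    cases hs
    exact h
  · exact fun h => ⟨[], w, s, rfl, .nil s, h⟩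

theorem not_resumes_cons_nil {A : HlTOPL V m n k} {x : Guard m n × Action m n}
    {gas : List (Guard m n × Action m n)} {q : Fin k} {s : Fin m → V} :
    ¬ A.Resumes (x :: gas) q s [] := by
  rintro ⟨u, w', s', h, hs, -⟩
  exact fires_cons_nil s x gas ⟨u, w', s', h, hs⟩

theorem resumes_cons_cons {A : HlTOPL V m n k} {x : Guard m n × Action m n}
    {gas : List (Guard m n × Action m n)} {q : Fin k} {s : Fin m → V} {ℓ : Fin n → V}
    {w : List (Fin n → V)} :
    A.Resumes (x :: gas) q s (ℓ :: w) ↔ x.1.Sat s ℓ ∧ A.Resumes gas q (x.2.run ℓ s) w := by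
  constructor
  · rintro ⟨u, w', s', h, hs, hacc⟩
    cases hs with
    | cons hg hs =>
      obtain ⟨rfl, rfl⟩ := by simpa using h
      exact ⟨hg, _, _, _, rfl, hs, hacc⟩
  · rintro ⟨hg, u, w', s', rfl, hs, hacc⟩
    exact ⟨ℓ :: u, w', s', rfl, .cons hg hs, hacc⟩

theorem accepts_of_mem {A : HlTOPL V m n k} {q q' : Fin k} {gas} {s : Fin m → V}
    {w : List (Fin n → V)} (hδ : (q, gas, q') ∈ A.δ) (h : A.Resumes gas q' s w) :
    A.Accepts q s w := by
  obtain ⟨u, w', s', rfl, hs, u', q₁, s₁, hp, hq₁⟩ := h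
  exact ⟨_, q₁, s₁, .cons (.std hδ hs) hp, hq₁⟩

theorem accepts_of_silent {A : HlTOPL V m n k} {q q' : Fin k} {s : Fin m → V}
    {w : List (Fin n → V)} (h : A.Silent q q') (hacc : A.Accepts q' s w) : A.Accepts q s w := by
  induction h using Relation.ReflTransGen.head_induction_on with
  | refl => exact hacc
  | head h _ ih => exact accepts_of_mem h (resumes_nil.2 ih)

theorem accepts_nil {A : HlTOPL V m n k} {q : Fin k} {s : Fin m → V} :
    A.Accepts q s [] ↔ ∃ q', A.Silent q q' ∧ q' ∈ A.F := by
  constructor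
  · rintro ⟨u, q', s', h, hq'⟩
    refine ⟨q', ?_, hq'⟩
    generalize hy : ((q, s), ([] : List (Fin n → V))) = y at h
    generalize hz : ((q', s'), ([] : List (Fin n → V))) = z at h
    induction h generalizing q s with
    | nil =>
      obtain ⟨⟨rfl, rfl⟩, -⟩ := by simpa using hy.trans hz.symm
      exact .refl
    | cons h _ ih =>
      cases h with
      | std hδ hs =>
        simp only [Prod.mk.injEq, List.nil_eq, List.append_eq_nil_iff] at hy
        obtain ⟨⟨rfl, rfl⟩, rfl, rfl⟩ := hy
        cases hs
        exact .head hδ (ih rfl hz)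
      | skip => simp at hy
  · rintro ⟨q', h, hq'⟩
    exact accepts_of_silent h ⟨[], q', s, .nil _, hq'⟩

theorem accepts_cons {A : HlTOPL V m n k} {q : Fin k} {s : Fin m → V} {ℓ : Fin n → V}
    {w : List (Fin n → V)} :
    A.Accepts q s (ℓ :: w) ↔ ∃ q₁, A.Silent q q₁ ∧
      ((∃ x gas q₂, (q₁, x :: gas, q₂) ∈ A.δ ∧ A.Resumes (x :: gas) q₂ s (ℓ :: w)) ∨
        (¬ A.StdFrom (q₁, s) (ℓ :: w) ∧ A.Accepts q₁ s w)) := by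
  constructor
  · rintro ⟨u, q', s', h, hq'⟩
    generalize hy : ((q, s), ℓ :: w) = y at h
    generalize hz : ((q', s'), ([] : List (Fin n → V))) = z at h
    induction h generalizing q s with
    | nil => simp [← hz] at hy
    | cons h hp ih =>
      subst hz
      cases h with
      | std hδ hs =>
        simp only [Prod.mk.injEq] at hy
        obtain ⟨⟨rfl, rfl⟩, hw⟩ := hy
        cases hs with
        | nil =>
          obtain ⟨q₁, h, h'⟩ := ih (by rw [hw]; rfl) rfl
          exact ⟨q₁, .head hδ h, h'⟩
        | cons hg hs =>
          refine ⟨q, .refl, .inl ⟨_, _, _, hδ, ?_⟩⟩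
          exact ⟨_, _, _, hw, .cons hg hs, _, _, _, hp, hq'⟩
      | skip hstd =>
        simp only [Prod.mk.injEq, List.cons.injEq] at hy
        obtain ⟨⟨rfl, rfl⟩, rfl, rfl⟩ := hy
        exact ⟨q, .refl, .inr ⟨hstd, _, _, _, hp, hq'⟩⟩
  · rintro ⟨q₁, h, ⟨x, gas, q₂, hδ, hr⟩ | ⟨hstd, u, q', s', hp, hq'⟩⟩
    · exact accepts_of_silent h (accepts_of_mem hδ hr)
    · exact accepts_of_silent h ⟨_, q', s', .cons (.skip hstd) hp, hq'⟩

end HlTOPL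

/-- Every TOPL automaton is simulated by a high-level one; moves to a dead state keep the
high-level automaton from skipping. -/
theorem TOPL.exists_hlTopl {V : Type} {m n k : ℕ} (A : TOPL V m n k) :
    ∃ B : HlTOPL V m n (k + 1), B.Lang = A.Lang := by
  classical
  let B : HlTOPL V m n (k + 1) :=
    { q₀ := A.q₀.castSucc
      s₀ := A.s₀
      δ := A.δ.image (fun t => (t.1.castSucc, [t.2.1], t.2.2.castSucc)) ∪
        Finset.univ.image fun q : Fin k => (q.castSucc, [(Guard.tt, Action.nop)], Fin.last k)
      F := A.F.image Fin.castSucc }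
  have hδ {q gas q'} : (q, gas, q') ∈ B.δ ↔
      (∃ t ∈ A.δ, t.1.castSucc = q ∧ [t.2.1] = gas ∧ t.2.2.castSucc = q') ∨
        ∃ p : Fin k, p.castSucc = q ∧ [(Guard.tt, Action.nop)] = gas ∧ Fin.last k = q' := by
    simp only [B, Finset.mem_union, Finset.mem_image, Finset.mem_univ, true_and, Prod.mk.injEq]
  have hsilent {q q'} : B.Silent q q' ↔ q = q' := by
    refine ⟨fun h => ?_, fun h => h ▸ .refl⟩
    induction h with
    | refl => rfl
    | tail _ h _ => simp [hδ] at h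
  have hF {q : Fin k} : q.castSucc ∈ B.F ↔ q ∈ A.F := by simp [B]
  have hdead (w : List (Fin n → V)) : ∀ s, ¬ B.Accepts (Fin.last k) s w := by
    induction w with
    | nil => simp [HlTOPL.accepts_nil, hsilent, B, Fin.castSucc_ne_last]
    | cons ℓ w ih => simp [HlTOPL.accepts_cons, hsilent, hδ, Fin.castSucc_ne_last, ih]
  have key (w : List (Fin n → V)) : ∀ q s, B.Accepts q.castSucc s w ↔ A.Accepts q s w := by
    induction w with
    | nil => simp [HlTOPL.accepts_nil, TOPL.accepts_nil, hsilent, hF]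
    | cons ℓ w ih =>
      intro q s
      rw [HlTOPL.accepts_cons, TOPL.accepts_cons]
      constructor
      · rintro ⟨q₁, h, ⟨x, gas, q₂, ht, hr⟩ | ⟨hstd, -⟩⟩
        · obtain rfl := hsilent.1 h
          rw [HlTOPL.resumes_cons_cons] at hr
          rcases hδ.1 ht with ⟨⟨p, ⟨g, a⟩, p'⟩, hA, hp, hx, rfl⟩ | ⟨p, hp, hx, rfl⟩
          · obtain ⟨rfl, rfl⟩ := by simpa using hx
            obtain rfl := Fin.castSucc_injective _ hp
            exact ⟨g, a, p', hA, hr.1, (ih _ _).1 (HlTOPL.resumes_nil.1 hr.2)⟩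
          · obtain ⟨rfl, rfl⟩ := by simpa using hx
            exact (hdead _ _ (HlTOPL.resumes_nil.1 hr.2)).elim
        · obtain rfl := hsilent.1 h
          refine (hstd (HlTOPL.stdFrom_iff.2
            ⟨_, hδ.2 (.inr ⟨q, rfl, rfl, rfl⟩), rfl, ?_⟩)).elim
          rw [HlTOPL.fires_cons_cons]
          exact ⟨trivial, HlTOPL.fires_nil _ _⟩
      · rintro ⟨g, a, q', hA, hg, hacc⟩
        refine ⟨_, hsilent.2 rfl, .inl ⟨(g, a), [], q'.castSucc,
          hδ.2 (.inl ⟨_, hA, rfl, rfl, rfl⟩), ?_⟩⟩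
        rw [HlTOPL.resumes_cons_cons, HlTOPL.resumes_nil, ih]
        exact ⟨hg, hacc⟩
  exact ⟨B, Set.ext fun w => HlTOPL.mem_lang.trans (key w _ _)⟩

namespace HlTOPL

variable {V : Type} {m n k : ℕ}

/-- A bound on the lengths of the transition labels. -/
def bound (A : HlTOPL V m n k) : ℕ := A.δ.sup fun t => t.2.1.length

/-- The slot `(t, j)` is used for checking that the transition `t`, which was tried `j + 1` letters
ago, cannot be completed. -/
abbrev Slot (A : HlTOPL V m n k) : Type := {t // t ∈ A.δ} × Fin A.bound

/-- The labels which remain to be processed in the middle of a transition. -/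
def Pending (A : HlTOPL V m n k) : Set (List (Guard m n × Action m n)) :=
  {gas | gas = [] ∨ ∃ t ∈ A.δ, gas <:+ t.2.1}

theorem finite_pending (A : HlTOPL V m n k) : A.Pending.Finite := by
  have : A.Pending ⊆ {[]} ∪ ⋃ t ∈ A.δ, {gas | gas ∈ t.2.1.tails} := by
    rintro gas (rfl | ⟨t, ht, h⟩)
    · simp
    · right
      simp only [Set.mem_iUnion]
      exact ⟨t, ht, (List.mem_tails _ _).2 h⟩
  exact ((Set.finite_singleton _).union
    (A.δ.finite_toSet.biUnion fun t _ => List.finite_toSet _)).subset this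

/-- Moves of the part of the simulating machine that follows a path, on a letter whose equality
pattern with the current store is `E`. The optional state is the one at which a letter is
skipped. -/
inductive Move (A : HlTOPL V m n k) (E : Fin m → Fin n → Prop) :
    List (Guard m n × Action m n) → Fin k → Option (Fin k) → Action m n →
    List (Guard m n × Action m n) → Fin k → Prop
  | resume {x gas q} : x.1.Holds E → Move A E (x :: gas) q none x.2 gas q
  | start {q q₁ x gas q₂} : A.Silent q q₁ → (q₁, x :: gas, q₂) ∈ A.δ → x.1.Holds E →
      Move A E [] q none x.2 gas q₂
  | skip {q q₁} : A.Silent q q₁ → Move A E [] q (some q₁) .nop [] q₁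

theorem Move.mem_pending {A : HlTOPL V m n k} {E gas q p a gas' q'}
    (h : A.Move E gas q p a gas' q') (hgas : gas ∈ A.Pending) : gas' ∈ A.Pending := by
  cases h with
  | resume =>
    obtain h | ⟨t, ht, h⟩ := hgas
    · simp at h
    · exact .inr ⟨t, ht, (List.suffix_cons _ _).trans h⟩
  | start _ hδ _ => exact .inr ⟨_, hδ, List.suffix_cons _ _⟩
  | skip => exact .inl rfl

theorem resumes_cons_iff_move {A : HlTOPL V m n k} {gas q} {s : Fin m → V} {ℓ : Fin n → V}
    {w : List (Fin n → V)} :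
    A.Resumes gas q s (ℓ :: w) ↔ ∃ p a gas' q', A.Move (fun i j => s i = ℓ j) gas q p a gas' q' ∧
      (∀ q₁ ∈ p, ¬ A.StdFrom (q₁, s) (ℓ :: w)) ∧ A.Resumes gas' q' (a.run ℓ s) w := by
  constructor
  · intro h
    cases gas with
    | nil =>
      obtain ⟨q₁, hq, ⟨x, gas, q₂, hδ, hr⟩ | ⟨hstd, hacc⟩⟩ := accepts_cons.1 (resumes_nil.1 h)
      · rw [resumes_cons_cons] at hr
        exact ⟨_, _, _, _, .start hq hδ ((Guard.holds_iff_sat _ _ _).2 hr.1), by simp, hr.2⟩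
      · exact ⟨_, _, _, _, .skip hq, by simpa using hstd, resumes_nil.2 hacc⟩
    | cons x gas =>
      rw [resumes_cons_cons] at h
      exact ⟨_, _, _, _, .resume ((Guard.holds_iff_sat _ _ _).2 h.1), by simp, h.2⟩
  · rintro ⟨p, a, gas', q', h, hstd, hr⟩
    cases h with
    | resume hg => exact resumes_cons_cons.2 ⟨(Guard.holds_iff_sat _ _ _).1 hg, hr⟩
    | start hq hδ hg =>
      exact resumes_nil.2 (accepts_cons.2 ⟨_, hq, .inl ⟨_, _, _, hδ,
        resumes_cons_cons.2 ⟨(Guard.holds_iff_sat _ _ _).1 hg, hr⟩⟩⟩)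
    | skip hq =>
      exact resumes_nil.2 (accepts_cons.2 ⟨_, hq, .inr ⟨hstd _ rfl, resumes_nil.1 hr⟩⟩)

/-- The thread whose store is used by the check of transition `t` at age `i`; `none` is the thread
that follows a path. -/
def thread (A : HlTOPL V m n k) (t : {t // t ∈ A.δ}) (i : Fin (A.bound + 1)) : Option A.Slot :=
  Fin.cases none (fun j => some (t, j)) i

/-- Whether the transition `t` is being checked at age `i`. -/
def Active (A : HlTOPL V m n k) (p : Option (Fin k)) (fl : A.Slot → Prop) (t : {t // t ∈ A.δ})
    (i : Fin (A.bound + 1)) : Prop :=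
  Fin.cases (p = some t.1.1) (fun j => fl (t, j)) i

/-- The checks that continue after a letter. -/
def advance (A : HlTOPL V m n k) (p : Option (Fin k)) (fl : A.Slot → Prop)
    (E : Option A.Slot → Fin m → Fin n → Prop) (σ : A.Slot) : Prop :=
  A.Active p fl σ.1 σ.2.castSucc ∧
    ∃ x ∈ σ.1.1.2.1[σ.2.1]?, x.1.Holds (E (A.thread σ.1 σ.2.castSucc))

/-- The thread from which a thread takes its new store, and the action performed on it. -/
def threadUpdate (A : HlTOPL V m n k) (a : Action m n) :
    Option A.Slot → Option A.Slot × Action m n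
  | none => (none, a)
  | some σ => (A.thread σ.1 σ.2.castSucc, (σ.1.1.2.1[σ.2.1]?.map Prod.snd).getD .nop)

/-- The machine that follows a path and checks that all skipped transitions fail. -/
def toCopyMachine (A : HlTOPL V m n k) :
    CopyMachine n ((A.Pending × Fin k) × (A.Slot → Prop)) (Option A.Slot × Fin m) where
  step x E u y := ∃ p a, A.Move (fun i => E (none, i)) x.1.1 x.1.2 p a y.1.1 y.1.2 ∧
    (∀ t i, A.Active p x.2 t i → t.1.2.1.drop i ≠ []) ∧
    y.2 = A.advance p x.2 (fun θ i => E (θ, i)) ∧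
    u = fun r => Sum.map (Prod.mk (A.threadUpdate a r.1).1) id
      ((A.threadUpdate a r.1).2.source r.2)
  final x := x.1.1.1 = [] ∧ (∃ q', A.Silent x.1.2 q' ∧ q' ∈ A.F) ∧
    ∀ σ : A.Slot, x.2 σ → σ.1.1.2.1.drop (σ.2 + 1) ≠ []

/-- No active check ever completes. -/
def Safe (A : HlTOPL V m n k) (fl : A.Slot → Prop) (s : Option A.Slot → Fin m → V)
    (w : List (Fin n → V)) : Prop :=
  ∀ σ : A.Slot, fl σ → ¬ Fires (s (some σ)) (σ.1.1.2.1.drop (σ.2 + 1)) w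

theorem safe_nil {A : HlTOPL V m n k} {fl : A.Slot → Prop} {s : Option A.Slot → Fin m → V} :
    A.Safe fl s [] ↔ ∀ σ : A.Slot, fl σ → σ.1.1.2.1.drop (σ.2 + 1) ≠ [] := by
  refine forall₂_congr fun σ _ => not_congr ?_
  cases σ.1.1.2.1.drop (σ.2 + 1) with
  | nil => simp [fires_nil]
  | cons x gas => simp [fires_cons_nil]

theorem safe_and_not_stdFrom_iff {A : HlTOPL V m n k} {fl : A.Slot → Prop}
    {s : Option A.Slot → Fin m → V} {w : List (Fin n → V)} {p : Option (Fin k)} :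
    (A.Safe fl s w ∧ ∀ q ∈ p, ¬ A.StdFrom (q, s none) w) ↔
      ∀ t i, A.Active p fl t i → ¬ Fires (s (A.thread t i)) (t.1.2.1.drop i) w := by
  constructor
  · rintro ⟨h₁, h₂⟩ t i
    refine Fin.cases (fun h hf => ?_) (fun j h => ?_) i
    · exact h₂ _ h (stdFrom_iff.2 ⟨t.1, t.2, rfl, hf⟩)
    · exact h₁ (t, j) h
  · intro h
    refine ⟨fun σ hσ => h σ.1 σ.2.succ hσ, fun q hq hstd => ?_⟩
    obtain ⟨t, ht, rfl, hf⟩ := stdFrom_iff.1 hstd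
    exact h ⟨t, ht⟩ 0 hq hf

theorem safe_advance {A : HlTOPL V m n k} {fl : A.Slot → Prop}
    {s : Option A.Slot → Fin m → V} {ℓ : Fin n → V} {w : List (Fin n → V)} {p : Option (Fin k)}
    (a : Action m n) :
    ((∀ t i, A.Active p fl t i → t.1.2.1.drop i ≠ []) ∧
      A.Safe (A.advance p fl fun θ i j => s θ i = ℓ j)
        (fun θ => (A.threadUpdate a θ).2.run ℓ (s (A.threadUpdate a θ).1)) w) ↔
      A.Safe fl s (ℓ :: w) ∧ ∀ q ∈ p, ¬ A.StdFrom (q, s none) (ℓ :: w) := by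
  rw [safe_and_not_stdFrom_iff]
  constructor
  · rintro ⟨hne, hsafe⟩ t i hact hf
    have hi : i.1 < t.1.2.1.length := by simpa using hne t i hact
    have hlen : t.1.2.1.length ≤ A.bound := Finset.le_sup (f := fun t => t.2.1.length) t.2
    obtain ⟨j, rfl⟩ : ∃ j : Fin A.bound, j.castSucc = i := ⟨⟨i, by omega⟩, rfl⟩
    simp only [Fin.val_castSucc] at hi
    rw [Fin.val_castSucc, List.drop_eq_getElem_cons hi, fires_cons_cons] at hf
    refine hsafe (t, j) ⟨hact, _, List.getElem?_eq_getElem hi, ?_⟩ ?_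
    · exact (Guard.holds_iff_sat _ _ _).2 hf.1
    · simpa [threadUpdate, List.getElem?_eq_getElem hi] using hf.2
  · refine fun h => ⟨fun t i hact hnil => h t i hact (hnil ▸ fires_nil _ _), ?_⟩
    rintro ⟨t, j⟩ ⟨hact, x, hx, hg⟩ hf
    refine h t j.castSucc hact ?_
    obtain ⟨hj, rfl⟩ := List.getElem?_eq_some_iff.1 hx
    rw [Fin.val_castSucc, List.drop_eq_getElem_cons hj, fires_cons_cons]
    refine ⟨(Guard.holds_iff_sat _ _ _).1 hg, ?_⟩
    simpa [threadUpdate, List.getElem?_eq_getElem hj] using hf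

theorem toCopyMachine_accepts {A : HlTOPL V m n k} (w : List (Fin n → V)) :
    ∀ (gas : A.Pending) (q : Fin k) (fl : A.Slot → Prop) (s : Option A.Slot × Fin m → V),
      A.toCopyMachine.Accepts ((gas, q), fl) s w ↔
        A.Resumes gas q (fun i => s (none, i)) w ∧ A.Safe fl (fun θ i => s (θ, i)) w := by
  induction w with
  | nil =>
    rintro ⟨gas, hgas⟩ q fl s
    rw [safe_nil]
    cases gas with
    | nil => simp [CopyMachine.Accepts, toCopyMachine, resumes_nil, accepts_nil]
    | cons x gas => simp [CopyMachine.Accepts, toCopyMachine, not_resumes_cons_nil]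
  | cons ℓ w ih =>
    intro gas q fl s
    have hupdate (a : Action m n) (θ : Option A.Slot) (i : Fin m) :
        Sum.elim s ℓ (Sum.map (Prod.mk (A.threadUpdate a θ).1) id
          ((A.threadUpdate a θ).2.source i)) =
        (A.threadUpdate a θ).2.run ℓ (fun i => s ((A.threadUpdate a θ).1, i)) i := by
      rw [Action.run_eq_elim_source]
      cases (A.threadUpdate a θ).2.source i <;> rfl
    rw [resumes_cons_iff_move, CopyMachine.Accepts]
    constructor
    · rintro ⟨u, ⟨⟨gas', q'⟩, fl'⟩, ⟨p, a, hmove, hne, rfl, rfl⟩, hacc⟩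
      rw [ih] at hacc
      simp only [hupdate] at hacc
      have := (safe_advance (s := fun θ i => s (θ, i)) (ℓ := ℓ) a).1 ⟨hne, hacc.2⟩
      exact ⟨⟨p, a, gas', q', hmove, this.2, hacc.1⟩, this.1⟩
    · rintro ⟨⟨p, a, gas', q', hmove, hstd, hr⟩, hsafe⟩
      have := (safe_advance (s := fun θ i => s (θ, i)) (ℓ := ℓ) a).2 ⟨hsafe, hstd⟩
      refine ⟨_, ((⟨gas', hmove.mem_pending gas.2⟩, q'), _),
        ⟨p, a, hmove, this.1, rfl, rfl⟩, ?_⟩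
      rw [ih]
      simp only [hupdate]
      exact ⟨hr, this.2⟩

/-- Every high-level TOPL automaton is simulated by a TOPL automaton. -/
theorem exists_topl [Nonempty V] (A : HlTOPL V m n k) :
    ∃ (m' k' : ℕ) (B : TOPL V m' n k'), B.Lang = A.Lang := by
  have := A.finite_pending.to_subtype
  obtain ⟨m', k', B, hB⟩ := A.toCopyMachine.exists_topl
    ((⟨[], .inl rfl⟩, A.q₀), fun _ => False) fun r => A.s₀ r.2
  refine ⟨m', k', B, hB.trans (Set.ext fun w => ?_)⟩
  rw [mem_lang, Set.mem_ofPred_eq, toCopyMachine_accepts, resumes_nil]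
  simp [Safe]

end HlTOPL

/-- TOPL automata and high-level TOPL automata are equally expressive: a language
`L ⊆ (V^n)*` is recognized by some TOPL automaton iff it is recognized by some
high-level TOPL automaton. -/
theorem topl_equiv_hlTopl (V : Type) [Infinite V] (n : ℕ) (L : Set (List (Fin n → V))) :
    (∃ (m k : ℕ) (A : TOPL V m n k), A.Lang = L) ↔
    (∃ (m k : ℕ) (A : HlTOPL V m n k), A.Lang = L) := by
  constructor
  · rintro ⟨m, k, A, rfl⟩
    obtain ⟨B, hB⟩ := A.exists_hlTopl
    exact ⟨m, k + 1, B, hB⟩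
  · rintro ⟨m, k, A, rfl⟩
    exact A.exists_topl

end Topl
end

section
/- The class of languages recognized by TOPL automata is closed under intersection: for any two TOPL automata A₁ and A₂ over the same alphabet Σ = V^n, there exists a TOPL automaton B over Σ with L(B) = L(A₁) ∩ L(A₂). -/
namespace Topl

/-- Renaming of the registers in a guard. -/
def Guard.map {m m' n : ℕ} (f : Fin m → Fin m') : Guard m n → Guard m' n
  | .eq i j => .eq (f i) j
  | .neq i j => .neq (f i) j
  | .tt => .tt
  | .and g₁ g₂ => .and (g₁.map f) (g₂.map f)

/-- Renaming of the registers in an action. -/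
def Action.map {m m' n : ℕ} (f : Fin m → Fin m') : Action m n → Action m' n
  | .nop => .nop
  | .set i j => .set (f i) j
  | .seq a₁ a₂ => .seq (a₁.map f) (a₂.map f)

theorem Guard.sat_map {V : Type} {m m' n : ℕ} (f : Fin m → Fin m') (s : Fin m' → V)
    (ℓ : Fin n → V) (g : Guard m n) : (g.map f).Sat s ℓ ↔ g.Sat (s ∘ f) ℓ := by
  induction g with
  | eq i j => rfl
  | neq i j => rfl
  | tt => rfl
  | and g₁ g₂ h₁ h₂ => exact and_congr h₁ h₂

theorem Action.run_map_comp {V : Type} {m m' n : ℕ} {f : Fin m → Fin m'}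
    (hf : Function.Injective f) (ℓ : Fin n → V) (a : Action m n) (s : Fin m' → V) :
    (a.map f).run ℓ s ∘ f = a.run ℓ (s ∘ f) := by
  induction a generalizing s with
  | nop => rfl
  | set i j => exact Function.update_comp_eq_of_injective s hf i (ℓ j)
  | seq a₁ a₂ h₁ h₂ => simp only [Action.map, Action.run, h₁, h₂]

theorem Action.run_map_comp_of_ne {V : Type} {m m' m'' n : ℕ} {f : Fin m → Fin m'}
    {f' : Fin m'' → Fin m'} (hf : ∀ i j, f i ≠ f' j) (ℓ : Fin n → V) (a : Action m n)
    (s : Fin m' → V) : (a.map f).run ℓ s ∘ f' = s ∘ f' := by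
  induction a generalizing s with
  | nop => rfl
  | set i j =>
    funext x
    simp [Action.map, Action.run, Function.update_of_ne (hf i x).symm]
  | seq a₁ a₂ h₁ h₂ => simp only [Action.map, Action.run, h₁, h₂]

theorem castAdd_ne_natAdd {m₁ m₂ : ℕ} (i : Fin m₁) (j : Fin m₂) :
    Fin.castAdd m₂ i ≠ Fin.natAdd m₁ j := by
  intro h
  have := congrArg Fin.val h
  simp only [Fin.val_castAdd, Fin.val_natAdd] at this
  omega

theorem store_ext {V : Type} {m₁ m₂ : ℕ} {s t : Fin (m₁ + m₂) → V}
    (h₁ : s ∘ Fin.castAdd m₂ = t ∘ Fin.castAdd m₂)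
    (h₂ : s ∘ Fin.natAdd m₁ = t ∘ Fin.natAdd m₁) : s = t := by
  funext i
  induction i using Fin.addCases with
  | left i => exact congrFun h₁ i
  | right i => exact congrFun h₂ i

namespace TOPL

variable {V : Type} {m₁ m₂ n k₁ k₂ : ℕ}

/-- The transition of the product automaton that performs `t₁` and `t₂` simultaneously. -/
def prodTransition
    (t₁ : Fin k₁ × (Guard m₁ n × Action m₁ n) × Fin k₁)
    (t₂ : Fin k₂ × (Guard m₂ n × Action m₂ n) × Fin k₂) :
    Fin (k₁ * k₂) × (Guard (m₁ + m₂) n × Action (m₁ + m₂) n) × Fin (k₁ * k₂) :=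
  (finProdFinEquiv (t₁.1, t₂.1),
    (.and (t₁.2.1.1.map (Fin.castAdd m₂)) (t₂.2.1.1.map (Fin.natAdd m₁)),
      .seq (t₁.2.1.2.map (Fin.castAdd m₂)) (t₂.2.1.2.map (Fin.natAdd m₁))),
    finProdFinEquiv (t₁.2.2, t₂.2.2))

/-- The synchronous product of two automata, on disjoint sets of registers. -/
def prod (A₁ : TOPL V m₁ n k₁) (A₂ : TOPL V m₂ n k₂) : TOPL V (m₁ + m₂) n (k₁ * k₂) where
  q₀ := finProdFinEquiv (A₁.q₀, A₂.q₀)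
  s₀ := Fin.append A₁.s₀ A₂.s₀
  δ := (A₁.δ ×ˢ A₂.δ).image fun t => prodTransition t.1 t.2
  F := (A₁.F ×ˢ A₂.F).image finProdFinEquiv

/-- The configuration of the product automaton given by a pair of configurations. -/
def pairConfig (x₁ : Fin k₁ × (Fin m₁ → V)) (x₂ : Fin k₂ × (Fin m₂ → V)) :
    Fin (k₁ * k₂) × (Fin (m₁ + m₂) → V) :=
  (finProdFinEquiv (x₁.1, x₂.1), Fin.append x₁.2 x₂.2)

theorem append_comp_castAdd (s₁ : Fin m₁ → V) (s₂ : Fin m₂ → V) :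
    Fin.append s₁ s₂ ∘ Fin.castAdd m₂ = s₁ :=
  funext fun i => Fin.append_left s₁ s₂ i

theorem append_comp_natAdd (s₁ : Fin m₁ → V) (s₂ : Fin m₂ → V) :
    Fin.append s₁ s₂ ∘ Fin.natAdd m₁ = s₂ :=
  funext fun i => Fin.append_right s₁ s₂ i

theorem exists_pairConfig (x : Fin (k₁ * k₂) × (Fin (m₁ + m₂) → V)) :
    ∃ x₁ x₂, x = pairConfig x₁ x₂ := by
  refine ⟨((finProdFinEquiv.symm x.1).1, x.2 ∘ Fin.castAdd m₂),
    ((finProdFinEquiv.symm x.1).2, x.2 ∘ Fin.natAdd m₁), Prod.ext ?_ ?_⟩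
  · exact (finProdFinEquiv.apply_symm_apply x.1).symm
  · exact store_ext (append_comp_castAdd _ _).symm (append_comp_natAdd _ _).symm

theorem pairConfig_inj {x₁ y₁ : Fin k₁ × (Fin m₁ → V)} {x₂ y₂ : Fin k₂ × (Fin m₂ → V)} :
    pairConfig x₁ x₂ = pairConfig y₁ y₂ ↔ x₁ = y₁ ∧ x₂ = y₂ := by
  refine ⟨fun h => ?_, fun ⟨h₁, h₂⟩ => h₁ ▸ h₂ ▸ rfl⟩
  have hq := Prod.ext_iff.1 (finProdFinEquiv.injective (congrArg Prod.fst h))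
  have hs : Fin.append x₁.2 x₂.2 = Fin.append y₁.2 y₂.2 := congrArg Prod.snd h
  refine ⟨Prod.ext hq.1 ?_, Prod.ext hq.2 ?_⟩
  · rw [← append_comp_castAdd x₁.2 x₂.2, hs, append_comp_castAdd]
  · rw [← append_comp_natAdd x₁.2 x₂.2, hs, append_comp_natAdd]

theorem run_seq_map_append (ℓ : Fin n → V) (a₁ : Action m₁ n) (a₂ : Action m₂ n)
    (s₁ : Fin m₁ → V) (s₂ : Fin m₂ → V) :
    (Action.seq (a₁.map (Fin.castAdd m₂)) (a₂.map (Fin.natAdd m₁))).run ℓ (Fin.append s₁ s₂) =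
      Fin.append (a₁.run ℓ s₁) (a₂.run ℓ s₂) := by
  apply store_ext
  · rw [append_comp_castAdd, Action.run, Action.run_map_comp (Fin.castAdd_injective m₁ m₂),
      Action.run_map_comp_of_ne fun i j => (castAdd_ne_natAdd j i).symm, append_comp_castAdd]
  · rw [append_comp_natAdd, Action.run, Action.run_map_comp_of_ne castAdd_ne_natAdd,
      Action.run_map_comp (Fin.natAdd_injective m₂ m₁), append_comp_natAdd]

theorem sat_and_map_append (ℓ : Fin n → V) (g₁ : Guard m₁ n) (g₂ : Guard m₂ n)
    (s₁ : Fin m₁ → V) (s₂ : Fin m₂ → V) :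
    (Guard.and (g₁.map (Fin.castAdd m₂)) (g₂.map (Fin.natAdd m₁))).Sat (Fin.append s₁ s₂) ℓ ↔
      g₁.Sat s₁ ℓ ∧ g₂.Sat s₂ ℓ := by
  rw [Guard.Sat, Guard.sat_map, Guard.sat_map, append_comp_castAdd, append_comp_natAdd]

theorem step_prod_iff (A₁ : TOPL V m₁ n k₁) (A₂ : TOPL V m₂ n k₂)
    (x₁ y₁ : Fin k₁ × (Fin m₁ → V)) (x₂ y₂ : Fin k₂ × (Fin m₂ → V)) (ℓ : Fin n → V) :
    (A₁.prod A₂).Step (pairConfig x₁ x₂) ℓ (pairConfig y₁ y₂) ↔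
      A₁.Step x₁ ℓ y₁ ∧ A₂.Step x₂ ℓ y₂ := by
  constructor
  · rintro ⟨g, a, hδ, hg, ha⟩
    obtain ⟨⟨⟨p₁, ⟨g₁, a₁⟩, r₁⟩, ⟨p₂, ⟨g₂, a₂⟩, r₂⟩⟩, ht, he⟩ := Finset.mem_image.1 hδ
    simp only [prodTransition, pairConfig, Prod.mk.injEq, EmbeddingLike.apply_eq_iff_eq] at he
    obtain ⟨⟨rfl, rfl⟩, ⟨rfl, rfl⟩, rfl, rfl⟩ := he
    obtain ⟨ht₁, ht₂⟩ := Finset.mem_product.1 ht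
    obtain ⟨hg₁, hg₂⟩ := (sat_and_map_append ℓ g₁ g₂ x₁.2 x₂.2).1 hg
    have hs : pairConfig (y₁.1, a₁.run ℓ x₁.2) (y₂.1, a₂.run ℓ x₂.2) = pairConfig y₁ y₂ :=
      Prod.ext rfl ((run_seq_map_append ℓ a₁ a₂ x₁.2 x₂.2).symm.trans ha)
    obtain ⟨hy₁, hy₂⟩ := pairConfig_inj.1 hs
    exact ⟨⟨g₁, a₁, ht₁, hg₁, congrArg Prod.snd hy₁⟩, ⟨g₂, a₂, ht₂, hg₂, congrArg Prod.snd hy₂⟩⟩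
  · rintro ⟨⟨g₁, a₁, ht₁, hg₁, ha₁⟩, ⟨g₂, a₂, ht₂, hg₂, ha₂⟩⟩
    refine ⟨_, _, Finset.mem_image.2 ⟨(_, _), Finset.mem_product.2 ⟨ht₁, ht₂⟩, rfl⟩,
      (sat_and_map_append ℓ g₁ g₂ x₁.2 x₂.2).2 ⟨hg₁, hg₂⟩, ?_⟩
    exact (run_seq_map_append ℓ a₁ a₂ x₁.2 x₂.2).trans (by rw [ha₁, ha₂]; rfl)

theorem reach_nil_iff {m k : ℕ} (A : TOPL V m n k) (x y : Fin k × (Fin m → V)) :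
    A.Reach x [] y ↔ x = y :=
  ⟨fun h => by cases h; rfl, fun h => h ▸ .nil x⟩

theorem reach_cons_iff {m k : ℕ} (A : TOPL V m n k) (x z : Fin k × (Fin m → V))
    (ℓ : Fin n → V) (w : List (Fin n → V)) :
    A.Reach x (ℓ :: w) z ↔ ∃ y, A.Step x ℓ y ∧ A.Reach y w z :=
  ⟨fun h => by cases h with | cons h₁ h₂ => exact ⟨_, h₁, h₂⟩, fun ⟨_, h₁, h₂⟩ => .cons h₁ h₂⟩

theorem reach_prod_iff (A₁ : TOPL V m₁ n k₁) (A₂ : TOPL V m₂ n k₂)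
    (x₁ y₁ : Fin k₁ × (Fin m₁ → V)) (x₂ y₂ : Fin k₂ × (Fin m₂ → V))
    (w : List (Fin n → V)) :
    (A₁.prod A₂).Reach (pairConfig x₁ x₂) w (pairConfig y₁ y₂) ↔
      A₁.Reach x₁ w y₁ ∧ A₂.Reach x₂ w y₂ := by
  induction w generalizing x₁ x₂ with
  | nil => simp only [reach_nil_iff, pairConfig_inj]
  | cons ℓ w ih =>
    simp only [reach_cons_iff]
    constructor
    · rintro ⟨z, hz, hw⟩
      obtain ⟨z₁, z₂, rfl⟩ := exists_pairConfig z
      obtain ⟨hz₁, hz₂⟩ := (step_prod_iff ..).1 hz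
      obtain ⟨hw₁, hw₂⟩ := (ih ..).1 hw
      exact ⟨⟨z₁, hz₁, hw₁⟩, ⟨z₂, hz₂, hw₂⟩⟩
    · rintro ⟨⟨z₁, hz₁, hw₁⟩, ⟨z₂, hz₂, hw₂⟩⟩
      exact ⟨pairConfig z₁ z₂, (step_prod_iff ..).2 ⟨hz₁, hz₂⟩, (ih ..).2 ⟨hw₁, hw₂⟩⟩

theorem pairConfig_mem_final_iff (A₁ : TOPL V m₁ n k₁) (A₂ : TOPL V m₂ n k₂)
    (x₁ : Fin k₁ × (Fin m₁ → V)) (x₂ : Fin k₂ × (Fin m₂ → V)) :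
    (pairConfig x₁ x₂).1 ∈ (A₁.prod A₂).F ↔ x₁.1 ∈ A₁.F ∧ x₂.1 ∈ A₂.F :=
  (finProdFinEquiv.injective.mem_finset_image).trans Finset.mem_product

theorem lang_prod (A₁ : TOPL V m₁ n k₁) (A₂ : TOPL V m₂ n k₂) :
    (A₁.prod A₂).Lang = A₁.Lang ∩ A₂.Lang := by
  ext w
  constructor
  · rintro ⟨x, hx, hF⟩
    obtain ⟨x₁, x₂, rfl⟩ := exists_pairConfig x
    obtain ⟨hx₁, hx₂⟩ := (reach_prod_iff A₁ A₂ (A₁.q₀, A₁.s₀) x₁ (A₂.q₀, A₂.s₀) x₂ w).1 hx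
    obtain ⟨hF₁, hF₂⟩ := (pairConfig_mem_final_iff ..).1 hF
    exact ⟨⟨x₁, hx₁, hF₁⟩, ⟨x₂, hx₂, hF₂⟩⟩
  · rintro ⟨⟨x₁, hx₁, hF₁⟩, ⟨x₂, hx₂, hF₂⟩⟩
    exact ⟨pairConfig x₁ x₂, (reach_prod_iff ..).2 ⟨hx₁, hx₂⟩,
      (pairConfig_mem_final_iff ..).2 ⟨hF₁, hF₂⟩⟩

end TOPL

/-- TOPL-recognizable languages are closed under intersection. -/
theorem topl_closed_under_intersection (V : Type) [Infinite V] (n : ℕ)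
    (m₁ k₁ m₂ k₂ : ℕ) (A₁ : TOPL V m₁ n k₁) (A₂ : TOPL V m₂ n k₂) :
    ∃ (m k : ℕ) (B : TOPL V m n k), B.Lang = A₁.Lang ∩ A₂.Lang := by
  exact ⟨m₁ + m₂, k₁ * k₂, A₁.prod A₂, A₁.lang_prod A₂⟩

end Topl
end

section
/- The class of languages recognized by TOPL automata is closed under Kleene star: for any TOPL automaton A over an alphabet Σ = V^n, there exists a TOPL automaton B over Σ with L(B) = L(A)* , the set of all finite concatenations (including the empty word) of words from L(A). -/
namespace Topl

/-- The Kleene star of a language of words: all finite concatenations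
(including the empty word) of words from `L`. -/
def kstar {α : Type} (L : Set (List α)) : Set (List α) :=
  { w | ∃ ws : List (List α), (∀ u ∈ ws, u ∈ L) ∧ w = ws.flatten }

/-- Mark the registers written by an action. -/
def Action.mark {m n : ℕ} : Action m n → (Fin m → Bool) → (Fin m → Bool)
  | .nop, d => d
  | .set i _, d => Function.update d i true
  | .seq a₁ a₂, d => a₁.mark (a₂.mark d)

/-- The register of the doubled store that holds the current value of register `i`: a register that
has been marked as written lives in the second half, and otherwise in the first half. -/
def liveReg {m : ℕ} (d : Fin m → Bool) (i : Fin m) : Fin (m + m) :=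
  if d i then Fin.natAdd m i else Fin.castAdd m i

theorem Action.run_map_of_notMem_range {V : Type} {m m' n : ℕ} {f : Fin m → Fin m'}
    {r : Fin m'} (hr : r ∉ Set.range f) (ℓ : Fin n → V) (a : Action m n) (s : Fin m' → V) :
    (a.map f).run ℓ s r = s r := by
  induction a generalizing s with
  | nop => rfl
  | set i j => exact Function.update_of_ne (fun h => hr ⟨i, h.symm⟩) _ _
  | seq a₁ a₂ ih₁ ih₂ => exact (ih₁ _).trans (ih₂ _)

theorem Action.run_map_natAdd_castAdd {V : Type} {m n : ℕ} (ℓ : Fin n → V) (a : Action m n)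
    (s : Fin (m + m) → V) (i : Fin m) :
    (a.map (Fin.natAdd m)).run ℓ s (Fin.castAdd m i) = s (Fin.castAdd m i) := by
  refine a.run_map_of_notMem_range ?_ ℓ s
  rintro ⟨j, hj⟩
  have := congrArg Fin.val hj
  simp only [Fin.val_natAdd, Fin.val_castAdd] at this
  omega

theorem Action.run_map_comp_liveReg {V : Type} {m n : ℕ} (ℓ : Fin n → V) (a : Action m n)
    (d : Fin m → Bool) (s : Fin (m + m) → V) :
    (a.map (Fin.natAdd m)).run ℓ s ∘ liveReg (a.mark d) = a.run ℓ (s ∘ liveReg d) := by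
  induction a generalizing d s with
  | nop => rfl
  | set i j =>
    funext r
    by_cases h : r = i
    · subst h
      simp [Action.map, Action.run, Action.mark, liveReg]
    · have hne : liveReg d r ≠ Fin.natAdd m i := by
        intro h'
        have := congrArg Fin.val h'
        have hv : r.val ≠ i.val := fun hv => h (Fin.ext hv)
        unfold liveReg at this
        split_ifs at this <;> simp only [Fin.val_natAdd, Fin.val_castAdd] at this <;> omega
      have hreg : liveReg (Function.update d i true) r = liveReg d r := by
        simp [liveReg, h]
      change Function.update s (Fin.natAdd m i) (ℓ j) (liveReg (Function.update d i true) r) =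
        Function.update (s ∘ liveReg d) i (ℓ j) r
      rw [hreg, Function.update_of_ne hne, Function.update_of_ne h]
      rfl
  | seq a₁ a₂ ih₁ ih₂ =>
    simp only [Action.map, Action.run, Action.mark]
    rw [ih₁, ih₂]

section KStar

variable {α : Type} {L : Set (List α)}

theorem nil_mem_kstar : [] ∈ kstar L := ⟨[], by simp, rfl⟩

theorem append_mem_kstar {u v : List α} (hu : u ∈ L) (hv : v ∈ kstar L) : u ++ v ∈ kstar L := by
  obtain ⟨ws, hws, rfl⟩ := hv
  exact ⟨u :: ws, List.forall_mem_cons.2 ⟨hu, hws⟩, rfl⟩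

end KStar

namespace TOPL

variable {V : Type} {m n k : ℕ}

theorem Reach.append {A : TOPL V m n k} {x y z : Fin k × (Fin m → V)} {u v : List (Fin n → V)}
    (hu : A.Reach x u y) (hv : A.Reach y v z) : A.Reach x (u ++ v) z := by
  induction hu with
  | nil => exact hv
  | cons hs _ ih => exact .cons hs (ih hv)

/-- States of the star automaton: `none` is the boundary between two words, and `some (q, d)` is
the state `q` together with the set `d` of registers written since the last boundary. -/
abbrev StarState (m k : ℕ) : Type := Option (Fin k × (Fin m → Bool))

/-- The numbering of the states of the star automaton. -/
noncomputable def starEquiv (m k : ℕ) : StarState m k ≃ Fin (Fintype.card (StarState m k)) :=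
  Fintype.equivFin _

/-- The state and the written registers simulated by a state of the star automaton. -/
def starBase (A : TOPL V m n k) (p : StarState m k) : Fin k × (Fin m → Bool) :=
  p.getD (A.q₀, fun _ => false)

/-- The configuration simulated by a configuration of the star automaton. -/
def starConf (A : TOPL V m n k) (p : StarState m k) (s : Fin (m + m) → V) :
    Fin k × (Fin m → V) :=
  ((A.starBase p).1, s ∘ liveReg (A.starBase p).2)

open Classical in
/-- An automaton for the Kleene star. The first half of its store permanently holds the initial
store; the second half holds the registers written since the last boundary. -/
noncomputable def star (A : TOPL V m n k) :
    TOPL V (m + m) n (Fintype.card (StarState m k)) where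
  q₀ := starEquiv m k none
  s₀ := Fin.append A.s₀ A.s₀
  δ :=
    let T := (Finset.univ ×ˢ A.δ).filter fun t => (A.starBase t.1).1 = t.2.1
    let label (t : StarState m k × Fin k × (Guard m n × Action m n) × Fin k) :=
      (t.2.2.1.1.map (liveReg (A.starBase t.1).2), t.2.2.1.2.map (Fin.natAdd m))
    T.image (fun t => (starEquiv m k t.1, label t,
        starEquiv m k (some (t.2.2.2, t.2.2.1.2.mark (A.starBase t.1).2)))) ∪
      (T.filter fun t => t.2.2.2 ∈ A.F).image
        (fun t => (starEquiv m k t.1, label t, starEquiv m k none))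
  F := {starEquiv m k none}

theorem star_step_iff (A : TOPL V m n k) (p p' : StarState m k) (s s' : Fin (m + m) → V)
    (ℓ : Fin n → V) :
    A.star.Step (starEquiv m k p, s) ℓ (starEquiv m k p', s') ↔
      ∃ g a q, ((A.starBase p).1, (g, a), q) ∈ A.δ ∧ g.Sat (A.starConf p s).2 ℓ ∧
        (a.map (Fin.natAdd m)).run ℓ s = s' ∧
        (p' = some (q, a.mark (A.starBase p).2) ∨ p' = none ∧ q ∈ A.F) := by
  constructor
  · rintro ⟨g', a', hδ, hg, ha⟩
    simp only [star, Finset.mem_union, Finset.mem_image, Finset.mem_filter, Finset.mem_product,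
      Finset.mem_univ, true_and, Prod.mk.injEq, EmbeddingLike.apply_eq_iff_eq] at hδ
    rcases hδ with ⟨⟨p₀, q₀, ⟨g, a⟩, q⟩, ⟨hA, hq⟩, rfl, ⟨rfl, rfl⟩, rfl⟩ |
      ⟨⟨p₀, q₀, ⟨g, a⟩, q⟩, ⟨⟨hA, hq⟩, hF⟩, rfl, ⟨rfl, rfl⟩, rfl⟩
    · exact ⟨g, a, q, hq ▸ hA, (Guard.sat_map (liveReg _) s _ _).1 hg, ha, .inl rfl⟩
    · exact ⟨g, a, q, hq ▸ hA, (Guard.sat_map (liveReg _) s _ _).1 hg, ha, .inr ⟨rfl, hF⟩⟩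
  · rintro ⟨g, a, q, hA, hg, ha, hp⟩
    refine ⟨g.map (liveReg (A.starBase p).2), a.map (Fin.natAdd m), ?_,
      (Guard.sat_map _ _ _ _).2 hg, ha⟩
    simp only [star, Finset.mem_union, Finset.mem_image, Finset.mem_filter, Finset.mem_product,
      Finset.mem_univ, true_and]
    rcases hp with rfl | ⟨rfl, hF⟩
    · exact .inl ⟨(p, _, (g, a), q), ⟨hA, rfl⟩, rfl⟩
    · exact .inr ⟨(p, _, (g, a), q), ⟨⟨hA, rfl⟩, hF⟩, rfl⟩

/-- The first half of the store holds the initial store of `A`. -/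
def Retains (A : TOPL V m n k) (s : Fin (m + m) → V) : Prop :=
  ∀ i, s (Fin.castAdd m i) = A.s₀ i

theorem retains_star (A : TOPL V m n k) : A.Retains A.star.s₀ := fun i => by
  simp [star]

theorem Retains.run {A : TOPL V m n k} {s : Fin (m + m) → V} (hs : A.Retains s)
    (ℓ : Fin n → V) (a : Action m n) : A.Retains ((a.map (Fin.natAdd m)).run ℓ s) := fun i =>
  (a.run_map_natAdd_castAdd ℓ s i).trans (hs i)

theorem Retains.starConf_none {A : TOPL V m n k} {s : Fin (m + m) → V} (hs : A.Retains s) :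
    A.starConf none s = (A.q₀, A.s₀) :=
  Prod.ext rfl (funext hs)

theorem starConf_some_mark (A : TOPL V m n k) (p : StarState m k) (s : Fin (m + m) → V)
    (ℓ : Fin n → V) (a : Action m n) (q : Fin k) :
    A.starConf (some (q, a.mark (A.starBase p).2)) ((a.map (Fin.natAdd m)).run ℓ s) =
      (q, a.run ℓ (A.starConf p s).2) :=
  Prod.ext rfl (a.run_map_comp_liveReg ℓ _ s)

theorem star_reach_of_reach {A : TOPL V m n k} {x y : Fin k × (Fin m → V)}
    {w : List (Fin n → V)} (h : A.Reach x w y) (hy : y.1 ∈ A.F) (hw : w ≠ [])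
    {p : StarState m k} {s : Fin (m + m) → V} (hs : A.Retains s) (hx : A.starConf p s = x) :
    ∃ s', A.Retains s' ∧ A.star.Reach (starEquiv m k p, s) w (starEquiv m k none, s') := by
  induction h generalizing p s with
  | nil => exact absurd rfl hw
  | @cons x₁ x₂ x₃ ℓ w hstep hreach ih =>
    subst hx
    obtain ⟨g, a, hA, hg, ha⟩ := hstep
    rcases eq_or_ne w [] with rfl | hw'
    · cases hreach
      exact ⟨_, hs.run ℓ a, .cons
        ((A.star_step_iff _ _ _ _ _).2 ⟨g, a, _, hA, hg, rfl, .inr ⟨rfl, hy⟩⟩) (.nil _)⟩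
    · obtain ⟨s', hs', hr⟩ := ih hy hw' (p := some (x₂.1, a.mark (A.starBase p).2))
        (hs.run ℓ a) (by rw [starConf_some_mark, ha])
      exact ⟨s', hs', .cons
        ((A.star_step_iff _ _ _ _ _).2 ⟨g, a, _, hA, hg, rfl, .inl rfl⟩) hr⟩

theorem star_reach_of_forall_mem_lang (A : TOPL V m n k) (ws : List (List (Fin n → V)))
    (hws : ∀ u ∈ ws, u ∈ A.Lang) {s : Fin (m + m) → V} (hs : A.Retains s) :
    ∃ s', A.star.Reach (starEquiv m k none, s) ws.flatten (starEquiv m k none, s') := by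
  induction ws generalizing s with
  | nil => exact ⟨s, .nil _⟩
  | cons u ws ih =>
    obtain ⟨hu, hws'⟩ := List.forall_mem_cons.1 hws
    rcases eq_or_ne u [] with rfl | hne
    · exact ih hws' hs
    · obtain ⟨y, hy, hF⟩ := hu
      obtain ⟨s₁, hs₁, h₁⟩ := star_reach_of_reach hy hF hne hs hs.starConf_none
      obtain ⟨s₂, h₂⟩ := ih hws' hs₁
      exact ⟨s₂, h₁.append h₂⟩

theorem exists_append_of_star_reach {A : TOPL V m n k} {p : StarState m k}
    {s : Fin (m + m) → V} {w : List (Fin n → V)}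
    {z : Fin (Fintype.card (StarState m k)) × (Fin (m + m) → V)}
    (h : A.star.Reach (starEquiv m k p, s) w z) (hz : z.1 = starEquiv m k none)
    (hs : A.Retains s) :
    (p = none ∧ w = []) ∨ ∃ u v y, w = u ++ v ∧ A.Reach (A.starConf p s) u y ∧ y.1 ∈ A.F ∧
      v ∈ kstar A.Lang := by
  generalize hc : (starEquiv m k p, s) = c at h
  induction h generalizing p s with
  | nil =>
    subst hc
    exact .inl ⟨(starEquiv m k).injective hz, rfl⟩
  | @cons x₁ x₂ x₃ ℓ w hstep _ ih =>
    subst hc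
    obtain ⟨r, s'⟩ := x₂
    obtain ⟨p', rfl⟩ := (starEquiv m k).surjective r
    obtain ⟨g, a, q, hA, hg, rfl, hp⟩ := (A.star_step_iff _ _ _ _ _).1 hstep
    have hs' := hs.run ℓ a
    have hstepA : A.Step (A.starConf p s) ℓ (q, a.run ℓ (A.starConf p s).2) :=
      ⟨g, a, hA, hg, rfl⟩
    right
    rcases hp with rfl | ⟨rfl, hF⟩
    · rcases ih hz hs' rfl with ⟨h, -⟩ | ⟨u, v, y, rfl, hr, hy, hv⟩
      · cases h
      · refine ⟨ℓ :: u, v, y, rfl, .cons hstepA ?_, hy, hv⟩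
        rwa [starConf_some_mark] at hr
    · refine ⟨[ℓ], w, _, rfl, .cons hstepA (.nil _), hF, ?_⟩
      rcases ih hz hs' rfl with ⟨-, rfl⟩ | ⟨u, v, y, rfl, hr, hy, hv⟩
      · exact nil_mem_kstar
      · exact append_mem_kstar ⟨y, hs'.starConf_none ▸ hr, hy⟩ hv

theorem lang_star (A : TOPL V m n k) : A.star.Lang = kstar A.Lang := by
  ext w
  constructor
  · rintro ⟨z, hr, hz⟩
    rcases exists_append_of_star_reach hr (Finset.mem_singleton.1 hz) A.retains_star with
      ⟨-, rfl⟩ | ⟨u, v, y, rfl, hu, hy, hv⟩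
    · exact nil_mem_kstar
    · exact append_mem_kstar ⟨y, A.retains_star.starConf_none ▸ hu, hy⟩ hv
  · rintro ⟨ws, hws, rfl⟩
    obtain ⟨s', h⟩ := A.star_reach_of_forall_mem_lang ws hws A.retains_star
    exact ⟨_, h, Finset.mem_singleton_self _⟩

end TOPL

/-- TOPL-recognizable languages are closed under Kleene star. -/
theorem topl_closed_under_kleeneStar (V : Type) [Infinite V] (n : ℕ)
    (m₁ k₁ : ℕ) (A : TOPL V m₁ n k₁) :
    ∃ (m k : ℕ) (B : TOPL V m n k), B.Lang = kstar A.Lang :=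
  ⟨_, _, A.star, A.lang_star⟩

end Topl
end

section
/- The class of languages recognized by TOPL automata is not closed under complementation: there exist an arity n and a TOPL automaton A over Σ = V^n such that no TOPL automaton B satisfies L(B) = Σ* \ L(A). -/
namespace Topl

theorem Guard.sat_congr {V : Type} {m n : ℕ} {s : Fin m → V} {ℓ ℓ' : Fin n → V}
    (h : ∀ i j, s i = ℓ j ↔ s i = ℓ' j) (g : Guard m n) :
    Guard.Sat s ℓ g ↔ Guard.Sat s ℓ' g := by
  induction g with
  | eq i j => exact h i j
  | neq i j => exact not_congr (h i j)
  | tt => exact Iff.rfl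
  | and g₁ g₂ ih₁ ih₂ => exact and_congr ih₁ ih₂

theorem Action.run_mem {V : Type} {m n : ℕ} {ℓ : Fin n → V} {S : Set V} (hℓ : ∀ j, ℓ j ∈ S)
    (a : Action m n) {s : Fin m → V} (hs : ∀ i, s i ∈ S) (i : Fin m) :
    Action.run ℓ a s i ∈ S := by
  induction a generalizing s i with
  | nop => exact hs i
  | set i' j =>
    by_cases h : i = i'
    · subst h
      simpa [Action.run] using hℓ j
    · simpa [Action.run, h] using hs i
  | seq a₁ a₂ ih₁ ih₂ => exact ih₁ (ih₂ hs) i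

namespace TOPL

variable {V : Type} {m n k : ℕ}

theorem Reach.store_mem {A : TOPL V m n k} {S : Set V} {x y : Fin k × (Fin m → V)}
    {w : List (Fin n → V)} (h : A.Reach x w y) (hw : ∀ ℓ ∈ w, ∀ j, ℓ j ∈ S)
    (hx : ∀ i, x.2 i ∈ S) (i : Fin m) : y.2 i ∈ S := by
  induction h with
  | nil x => exact hx i
  | cons hstep _ ih =>
    obtain ⟨g, a, -, -, ha⟩ := hstep
    refine ih (fun ℓ hℓ => hw ℓ (List.mem_cons_of_mem _ hℓ)) fun i' => ?_
    rw [← ha]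
    exact Action.run_mem (hw _ List.mem_cons_self) a hx i'

theorem reach_concat_iff {A : TOPL V m n k} {x z : Fin k × (Fin m → V)}
    {w : List (Fin n → V)} {ℓ : Fin n → V} :
    A.Reach x (w ++ [ℓ]) z ↔ ∃ y, A.Reach x w y ∧ A.Step y ℓ z := by
  induction w generalizing x with
  | nil =>
    constructor
    · rintro (_ | ⟨h, _ | _⟩)
      exact ⟨x, .nil x, h⟩
    · rintro ⟨y, _ | _, h⟩
      exact .cons h (.nil z)
  | cons ℓ' w ih =>
    constructor
    · rintro (_ | ⟨h, h'⟩)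
      obtain ⟨y, hy, hz⟩ := ih.1 h'
      exact ⟨y, .cons h hy, hz⟩
    · rintro ⟨y, _ | ⟨h, h'⟩, hz⟩
      exact .cons h (ih.2 ⟨y, h', hz⟩)

/-- If the last letter of an accepted word is new to the automaton, then it can be replaced by
some value from any sufficiently large set. -/
theorem exists_mem_concat_mem_lang (B : TOPL V m 1 k) {T : Finset V} (hT : m < T.card)
    {w : List (Fin 1 → V)} {y : V} (hw : ∀ ℓ ∈ w, ℓ 0 ≠ y) (hy : ∀ i, B.s₀ i ≠ y)
    (h : w ++ [fun _ => y] ∈ B.Lang) :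
    ∃ v ∈ T, w ++ [fun _ => v] ∈ B.Lang := by
  classical
  obtain ⟨z, hz, hF⟩ := h
  obtain ⟨c, hc, g, a, hδ, hg, -⟩ := reach_concat_iff.1 hz
  obtain ⟨v, hv, hvc⟩ : ∃ v ∈ T, v ∉ Finset.univ.image c.2 :=
    Finset.exists_mem_notMem_of_card_lt_card
      ((Finset.card_image_le.trans_eq (Finset.card_fin m)).trans_lt hT)
  have hcy : ∀ i, c.2 i ≠ y := hc.store_mem (S := {y}ᶜ)
    (fun ℓ hℓ j => by rw [Subsingleton.elim j 0]; exact hw ℓ hℓ) hy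
  have hcv : ∀ i, c.2 i ≠ v := fun i hi => hvc (by simp [← hi])
  refine ⟨v, hv, (z.1, Action.run (fun _ => v) a c.2), reach_concat_iff.2 ⟨c, hc, g, a, hδ, ?_, rfl⟩,
    hF⟩
  exact (Guard.sat_congr (fun i _ => iff_of_false (hcy i) (hcv i)) g).1 hg

/-- An automaton that guesses a letter and accepts if the last letter is a repetition of it. -/
def repeatLast (v : V) : TOPL V 1 1 3 where
  q₀ := 0
  s₀ := fun _ => v
  δ := {(0, (.tt, .nop), 0), (0, (.tt, .set 0 0), 1), (1, (.tt, .nop), 1), (1, (.eq 0 0, .nop), 2)}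
  F := {2}

theorem not_nodup_of_reach_repeatLast {v : V} {x y : Fin 3 × (Fin 1 → V)}
    {w : List (Fin 1 → V)} (h : (repeatLast v).Reach x w y) (hy : y.1 = 2) :
    (x.1 = 0 → ¬ w.Nodup) ∧ (x.1 = 1 → x.2 ∈ w) := by
  induction h with
  | nil x => simp [hy]
  | @cons x₁ x₂ x₃ ℓ w hstep _ ih =>
    obtain ⟨ih₀, ih₁⟩ := ih hy
    obtain ⟨g, a, hδ, hg, ha⟩ := hstep
    simp only [repeatLast, Finset.mem_insert, Finset.mem_singleton, Prod.mk.injEq] at hδ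
    rcases hδ with ⟨h₁, ⟨rfl, rfl⟩, h₂⟩ | ⟨h₁, ⟨rfl, rfl⟩, h₂⟩ | ⟨h₁, ⟨rfl, rfl⟩, h₂⟩ |
      ⟨h₁, ⟨rfl, rfl⟩, h₂⟩
    · simp [h₁, ih₀ h₂]
    · have hℓ : x₂.2 = ℓ := by
        rw [← ha]
        funext i
        simp [Action.run, Subsingleton.elim i 0]
      simp [h₁, ← hℓ, ih₁ h₂]
    · have hs : x₁.2 = x₂.2 := ha
      simp [h₁, hs, ih₁ h₂]
    · have hℓ : x₁.2 = ℓ := by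
        funext i
        rw [Subsingleton.elim i 0]
        exact hg
      simp [h₁, hℓ]

theorem not_mem_lang_repeatLast {v : V} {w : List (Fin 1 → V)} (hw : w.Nodup) :
    w ∉ (repeatLast v).Lang := by
  rintro ⟨x, hx, hF⟩
  exact (not_nodup_of_reach_repeatLast hx (by simpa [repeatLast] using hF)).1 rfl hw

theorem reach_repeatLast_loop (v : V) {q : Fin 3} (hq : q = 0 ∨ q = 1) (s : Fin 1 → V)
    (w : List (Fin 1 → V)) : (repeatLast v).Reach (q, s) w (q, s) := by
  induction w with
  | nil => exact .nil _
  | cons ℓ w ih =>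
    refine .cons ⟨.tt, .nop, ?_, trivial, rfl⟩ ih
    rcases hq with rfl | rfl <;> simp [repeatLast]

theorem concat_mem_lang_repeatLast {v : V} {w : List (Fin 1 → V)} {ℓ : Fin 1 → V}
    (hℓ : ℓ ∈ w) : w ++ [ℓ] ∈ (repeatLast v).Lang := by
  refine ⟨(2, ℓ), reach_concat_iff.2 ⟨(1, ℓ), ?_, .eq 0 0, .nop, by simp [repeatLast], rfl, rfl⟩,
    by simp [repeatLast]⟩
  induction w with
  | nil => simp at hℓ
  | cons ℓ' w ih =>
    rcases List.mem_cons.1 hℓ with rfl | h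
    · refine .cons ⟨.tt, .set 0 0, by simp [repeatLast], trivial, ?_⟩
        (reach_repeatLast_loop v (.inr rfl) ℓ w)
      funext i
      simp [Action.run, Subsingleton.elim i 0]
    · exact .cons ⟨.tt, .nop, by simp [repeatLast], trivial, rfl⟩ (ih h)

end TOPL

/-- TOPL-recognizable languages are not closed under complementation: there are an arity `n`
and a TOPL automaton `A` over `V^n` whose complement language `Σ* \ L(A)` is recognized by
no TOPL automaton. -/
theorem topl_not_closed_under_complement (V : Type) [Infinite V] :
    ∃ (n m k : ℕ) (A : TOPL V m n k),
      ¬ ∃ (m' k' : ℕ) (B : TOPL V m' n k'), B.Lang = A.Langᶜ := by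
  classical
  refine ⟨1, 1, 3, TOPL.repeatLast (Classical.arbitrary V), ?_⟩
  rintro ⟨m, k, B, hB⟩
  obtain ⟨T, hT⟩ := Infinite.exists_subset_card_eq V (m + 1)
  obtain ⟨y, hy⟩ := Infinite.exists_notMem_finset (T ∪ Finset.univ.image B.s₀)
  simp only [Finset.mem_union, Finset.mem_image, Finset.mem_univ, true_and, not_or,
    not_exists] at hy
  have hinj : Function.Injective fun (v : V) (_ : Fin 1) => v := fun _ _ h => congrFun h 0
  have hyw : ∀ ℓ ∈ T.toList.map fun v (_ : Fin 1) => v, ℓ 0 ≠ y := by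
    simp only [List.mem_map, Finset.mem_toList]
    rintro _ ⟨v, hv, rfl⟩ rfl
    exact hy.1 hv
  have hnodup : ((T.toList.map fun v (_ : Fin 1) => v) ++ [fun _ => y]).Nodup := by
    rw [← List.concat_eq_append, List.nodup_concat]
    exact ⟨fun h => hyw _ h rfl, T.nodup_toList.map hinj⟩
  obtain ⟨v, hv, hmem⟩ := B.exists_mem_concat_mem_lang (T := T) (by omega) hyw hy.2
    (by rw [hB]; exact TOPL.not_mem_lang_repeatLast hnodup)
  rw [hB] at hmem
  exact hmem (TOPL.concat_mem_lang_repeatLast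
    (List.mem_map_of_mem (Finset.mem_toList.2 hv)))

end Topl
end

section
/- The class of languages recognized by high-level TOPL automata is closed under union: for any two hl-TOPL automata A₁ and A₂ over the same alphabet Σ = V^n, there exists a hl-TOPL automaton B over Σ with L(B) = L(A₁) ∪ L(A₂). -/
namespace Topl

/-- Rename the registers of a guard. -/
def Guard.rename {m m' n : ℕ} (r : Fin m → Fin m') : Guard m n → Guard m' n
  | .eq i j => .eq (r i) j
  | .neq i j => .neq (r i) j
  | .tt => .tt
  | .and g₁ g₂ => .and (g₁.rename r) (g₂.rename r)

/-- Rename the registers of an action. -/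
def Action.rename {m m' n : ℕ} (r : Fin m → Fin m') : Action m n → Action m' n
  | .nop => .nop
  | .set i j => .set (r i) j
  | .seq a₁ a₂ => .seq (a₁.rename r) (a₂.rename r)

theorem Guard.sat_rename {V : Type} {m m' n : ℕ} (r : Fin m → Fin m') (s : Fin m' → V)
    (ℓ : Fin n → V) (g : Guard m n) : (g.rename r).Sat s ℓ ↔ g.Sat (s ∘ r) ℓ := by
  induction g with
  | eq i j => rfl
  | neq i j => rfl
  | tt => rfl
  | and g₁ g₂ ih₁ ih₂ => exact and_congr ih₁ ih₂

theorem Action.run_rename_comp {V : Type} {m m' n : ℕ} {r : Fin m → Fin m'}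
    (hr : Function.Injective r) (ℓ : Fin n → V) (a : Action m n) (s : Fin m' → V) :
    (a.rename r).run ℓ s ∘ r = a.run ℓ (s ∘ r) := by
  induction a generalizing s with
  | nop => rfl
  | set i j => exact Function.update_comp_eq_of_injective s hr i (ℓ j)
  | seq a₁ a₂ ih₁ ih₂ => simp only [Action.rename, Action.run, ih₁, ih₂]

/-- Rename the registers in a sequence of guard–action pairs. -/
def renameSeq {m m' n : ℕ} (r : Fin m → Fin m') (gas : List (Guard m n × Action m n)) :
    List (Guard m' n × Action m' n) :=
  gas.map fun p => (p.1.rename r, p.2.rename r)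

namespace HlTOPL

section Embedding

variable {V : Type} {m m' n k k' : ℕ}

theorem SeqAccept.of_rename {r : Fin m → Fin m'} (hr : Function.Injective r)
    {gas : List (Guard m n × Action m n)} {s s' : Fin m' → V} {w : List (Fin n → V)}
    (h : SeqAccept s (renameSeq r gas) w s') : SeqAccept (s ∘ r) gas w (s' ∘ r) := by
  induction gas generalizing s w with
  | nil => cases h; exact .nil _
  | cons p gas ih =>
    cases h with
    | cons hg h =>
      refine .cons ((Guard.sat_rename r _ _ _).1 hg) ?_
      rw [← Action.run_rename_comp hr]
      exact ih h

theorem SeqAccept.exists_rename {r : Fin m → Fin m'} (hr : Function.Injective r)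
    {gas : List (Guard m n × Action m n)} {s : Fin m' → V} {t : Fin m → V}
    {w : List (Fin n → V)} (h : SeqAccept (s ∘ r) gas w t) :
    ∃ s', s' ∘ r = t ∧ SeqAccept s (renameSeq r gas) w s' := by
  induction gas generalizing s w with
  | nil => cases h; exact ⟨s, rfl, .nil _⟩
  | cons p gas ih =>
    cases h with
    | cons hg h =>
      rw [← Action.run_rename_comp hr] at h
      obtain ⟨s', hs', hacc⟩ := ih h
      exact ⟨s', hs', .cons ((Guard.sat_rename r _ _ _).2 hg) hacc⟩

/-- `A` sits inside `B` via the state map `e` and the register map `r`: transitions of `B` out of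
the image of `e` are exactly the renamed transitions of `A`, and `e` preserves and reflects
finality. -/
structure Embeds (A : HlTOPL V m n k) (B : HlTOPL V m' n k') (e : Fin k → Fin k')
    (r : Fin m → Fin m') : Prop where
  injective : Function.Injective r
  mem_δ_iff : ∀ q gas' q', (e q, gas', q') ∈ B.δ ↔
    ∃ gas p, (q, gas, p) ∈ A.δ ∧ renameSeq r gas = gas' ∧ e p = q'
  mem_F_iff : ∀ q, e q ∈ B.F ↔ q ∈ A.F

namespace Embeds

variable {A : HlTOPL V m n k} {B : HlTOPL V m' n k'} {e : Fin k → Fin k'} {r : Fin m → Fin m'}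

theorem stdFrom_iff (h : Embeds A B e r) (q : Fin k) (s : Fin m' → V) (v : List (Fin n → V)) :
    B.StdFrom (e q, s) v ↔ A.StdFrom (q, s ∘ r) v := by
  constructor
  · rintro ⟨q₂, s₂, gas', u, u', rfl, hδ, hs⟩
    obtain ⟨gas, p, hp, rfl, rfl⟩ := (h.mem_δ_iff _ _ _).1 hδ
    exact ⟨p, _, gas, u, u', rfl, hp, hs.of_rename h.injective⟩
  · rintro ⟨p, t, gas, u, u', rfl, hδ, hs⟩
    obtain ⟨s', -, hs'⟩ := SeqAccept.exists_rename h.injective hs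
    exact ⟨e p, s', _, u, u', rfl, (h.mem_δ_iff _ _ _).2 ⟨gas, p, hδ, rfl, rfl⟩, hs'⟩

theorem path_of_path (h : Embeds A B e r) {y z : (Fin k' × (Fin m' → V)) × List (Fin n → V)}
    {w : List (Fin n → V)} (hp : B.Path y w z) (q : Fin k) (hq : y.1.1 = e q) :
    ∃ p, z.1.1 = e p ∧ A.Path ((q, y.1.2 ∘ r), y.2) w ((p, z.1.2 ∘ r), z.2) := by
  induction hp generalizing q with
  | nil y => exact ⟨q, hq, .nil _⟩
  | cons hstep _ ih =>
    cases hstep with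
    | std hδ hs =>
      subst hq
      obtain ⟨gas, p, hp, rfl, rfl⟩ := (h.mem_δ_iff _ _ _).1 hδ
      obtain ⟨p', hp', hpath⟩ := ih p rfl
      exact ⟨p', hp', .cons (.std hp (hs.of_rename h.injective)) hpath⟩
    | skip hn =>
      subst hq
      obtain ⟨p', hp', hpath⟩ := ih q rfl
      exact ⟨p', hp', .cons (.skip (mt (h.stdFrom_iff _ _ _).2 hn)) hpath⟩

theorem exists_path (h : Embeds A B e r) {y z : (Fin k × (Fin m → V)) × List (Fin n → V)}
    {w : List (Fin n → V)} (hp : A.Path y w z) (s : Fin m' → V) (hs : s ∘ r = y.1.2) :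
    ∃ t, B.Path ((e y.1.1, s), y.2) w ((e z.1.1, t), z.2) := by
  induction hp generalizing s with
  | nil y => exact ⟨s, .nil _⟩
  | cons hstep _ ih =>
    cases hstep with
    | std hδ hacc =>
      subst hs
      obtain ⟨s', hs', hacc'⟩ := SeqAccept.exists_rename h.injective hacc
      obtain ⟨t, ht⟩ := ih s' hs'
      exact ⟨t, .cons (.std ((h.mem_δ_iff _ _ _).2 ⟨_, _, hδ, rfl, rfl⟩) hacc') ht⟩
    | skip hn =>
      subst hs
      obtain ⟨t, ht⟩ := ih s rfl
      exact ⟨t, .cons (.skip (mt (h.stdFrom_iff _ _ _).1 hn)) ht⟩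

end Embeds

/-- If the initial state of `B` is not final and its transitions are exactly the empty sequences
into the initial states of two embedded automata, then `B` recognizes the union. -/
theorem lang_eq_union {m₁ m₂ k₁ k₂ : ℕ} {A₁ : HlTOPL V m₁ n k₁} {A₂ : HlTOPL V m₂ n k₂}
    {B : HlTOPL V m n k} {e₁ : Fin k₁ → Fin k} {e₂ : Fin k₂ → Fin k}
    {r₁ : Fin m₁ → Fin m} {r₂ : Fin m₂ → Fin m}
    (h₁ : Embeds A₁ B e₁ r₁) (h₂ : Embeds A₂ B e₂ r₂)
    (hs₁ : B.s₀ ∘ r₁ = A₁.s₀) (hs₂ : B.s₀ ∘ r₂ = A₂.s₀) (hF : B.q₀ ∉ B.F)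
    (hδ : ∀ gas q, (B.q₀, gas, q) ∈ B.δ ↔ gas = [] ∧ (q = e₁ A₁.q₀ ∨ q = e₂ A₂.q₀)) :
    B.Lang = A₁.Lang ∪ A₂.Lang := by
  ext w
  constructor
  · rintro ⟨w₀, q, s, hp, hq⟩
    generalize hy : ((B.q₀, B.s₀), w₀) = y at hp
    generalize hz : ((q, s), ([] : List (Fin n → V))) = z at hp
    cases hp with
    | nil =>
      subst hy
      simp only [Prod.mk.injEq] at hz
      exact absurd (hz.1.1 ▸ hq) hF
    | cons hstep hp =>
      subst hz
      cases hstep with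
      | std hmem hacc =>
        simp only [Prod.mk.injEq] at hy
        obtain ⟨⟨rfl, rfl⟩, -⟩ := hy
        obtain ⟨rfl, rfl | rfl⟩ := (hδ _ _).1 hmem
        · cases hacc
          obtain ⟨p, hqp, hp'⟩ := h₁.path_of_path hp _ rfl
          subst hqp
          exact .inl ⟨_, p, _, hs₁ ▸ hp', (h₁.mem_F_iff p).1 hq⟩
        · cases hacc
          obtain ⟨p, hqp, hp'⟩ := h₂.path_of_path hp _ rfl
          subst hqp
          exact .inr ⟨_, p, _, hs₂ ▸ hp', (h₂.mem_F_iff p).1 hq⟩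
      | skip hn =>
        simp only [Prod.mk.injEq] at hy
        obtain ⟨⟨rfl, rfl⟩, -⟩ := hy
        exact absurd ⟨_, _, [], [], _, rfl, (hδ _ _).2 ⟨rfl, .inl rfl⟩, .nil _⟩ hn
  · rintro (⟨w₀, q, s, hp, hq⟩ | ⟨w₀, q, s, hp, hq⟩)
    · obtain ⟨t, ht⟩ := h₁.exists_path hp B.s₀ hs₁
      exact ⟨w₀, e₁ q, t, .cons (.std (w := []) ((hδ _ _).2 ⟨rfl, .inl rfl⟩) (.nil _)) ht,
        (h₁.mem_F_iff q).2 hq⟩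
    · obtain ⟨t, ht⟩ := h₂.exists_path hp B.s₀ hs₂
      exact ⟨w₀, e₂ q, t, .cons (.std (w := []) ((hδ _ _).2 ⟨rfl, .inr rfl⟩) (.nil _)) ht,
        (h₂.mem_F_iff q).2 hq⟩

end Embedding

section Union

variable {V : Type} {n m₁ k₁ m₂ k₂ : ℕ}

/-- The state of the union automaton corresponding to a state of the left automaton. -/
def inlState (k₁ k₂ : ℕ) (q : Fin k₁) : Fin (k₁ + k₂ + 1) := (Fin.castAdd k₂ q).castSucc

/-- The state of the union automaton corresponding to a state of the right automaton. -/
def inrState (k₁ k₂ : ℕ) (q : Fin k₂) : Fin (k₁ + k₂ + 1) := (Fin.natAdd k₁ q).castSucc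

@[simp]
theorem inlState_inj {p q : Fin k₁} : inlState k₁ k₂ p = inlState k₁ k₂ q ↔ p = q := by
  simp [inlState, Fin.ext_iff]

@[simp]
theorem inrState_inj {p q : Fin k₂} : inrState k₁ k₂ p = inrState k₁ k₂ q ↔ p = q := by
  simp [inrState, Fin.ext_iff]

@[simp]
theorem inlState_ne_inrState (p : Fin k₁) (q : Fin k₂) :
    inlState k₁ k₂ p ≠ inrState k₁ k₂ q := by
  simp only [inlState, inrState, ne_eq, Fin.ext_iff, Fin.val_castSucc, Fin.val_castAdd,
    Fin.val_natAdd]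
  omega

@[simp]
theorem inlState_ne_last (p : Fin k₁) : inlState k₁ k₂ p ≠ Fin.last (k₁ + k₂) :=
  (Fin.castSucc_lt_last _).ne

@[simp]
theorem inrState_ne_last (p : Fin k₂) : inrState k₁ k₂ p ≠ Fin.last (k₁ + k₂) :=
  (Fin.castSucc_lt_last _).ne

open Classical in
/-- The disjoint union of two automata, with a fresh initial state from which empty sequences
lead to both initial states. -/
noncomputable def union (A₁ : HlTOPL V m₁ n k₁) (A₂ : HlTOPL V m₂ n k₂) :
    HlTOPL V (m₁ + m₂) n (k₁ + k₂ + 1) where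
  q₀ := Fin.last _
  s₀ := Fin.append A₁.s₀ A₂.s₀
  δ := A₁.δ.image (fun t => (inlState k₁ k₂ t.1, renameSeq (Fin.castAdd m₂) t.2.1,
        inlState k₁ k₂ t.2.2)) ∪
      A₂.δ.image (fun t => (inrState k₁ k₂ t.1, renameSeq (Fin.natAdd m₁) t.2.1,
        inrState k₁ k₂ t.2.2)) ∪
      {(Fin.last _, [], inlState k₁ k₂ A₁.q₀), (Fin.last _, [], inrState k₁ k₂ A₂.q₀)}
  F := A₁.F.image (inlState k₁ k₂) ∪ A₂.F.image (inrState k₁ k₂)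

theorem embeds_union_left (A₁ : HlTOPL V m₁ n k₁) (A₂ : HlTOPL V m₂ n k₂) :
    Embeds A₁ (A₁.union A₂) (inlState k₁ k₂) (Fin.castAdd m₂) where
  injective := Fin.castAdd_injective m₁ m₂
  mem_δ_iff q gas' q' := by simp [union, (inlState_ne_inrState _ _).symm]
  mem_F_iff q := by simp [union, (inlState_ne_inrState _ _).symm]

theorem embeds_union_right (A₁ : HlTOPL V m₁ n k₁) (A₂ : HlTOPL V m₂ n k₂) :
    Embeds A₂ (A₁.union A₂) (inrState k₁ k₂) (Fin.natAdd m₁) where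
  injective := Fin.natAdd_injective m₂ m₁
  mem_δ_iff q gas' q' := by simp [union]
  mem_F_iff q := by simp [union]

theorem lang_union (A₁ : HlTOPL V m₁ n k₁) (A₂ : HlTOPL V m₂ n k₂) :
    (A₁.union A₂).Lang = A₁.Lang ∪ A₂.Lang := by
  refine lang_eq_union (embeds_union_left A₁ A₂) (embeds_union_right A₁ A₂) ?_ ?_ ?_ ?_
  · ext i; simp [union]
  · ext i; simp [union]
  · simp [union]
  · intro gas q
    simp [union, ← and_or_left]

end Union

end HlTOPL

/-- hl-TOPL-recognizable languages are closed under union. -/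
theorem hlTopl_closed_under_union (V : Type) [Infinite V] (n : ℕ)
    (m₁ k₁ m₂ k₂ : ℕ) (A₁ : HlTOPL V m₁ n k₁) (A₂ : HlTOPL V m₂ n k₂) :
    ∃ (m k : ℕ) (B : HlTOPL V m n k), B.Lang = A₁.Lang ∪ A₂.Lang :=
  ⟨_, _, A₁.union A₂, HlTOPL.lang_union A₁ A₂⟩

end Topl
end
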